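/- arXiv:2010.07902 — 2 statements merged into one kernel-verified Lean document; each statement's English description precedes it below -/
import Mathlib

section
/- Entanglement-assisted quantum Singleton bound, case 2(d−1) ≥ n. Let q ≥ 2, K ≥ 1, 2 ≤ d ≤ n, and 2(d−1) ≥ n. Let ψ be a pure quantum state on R ⊗ A_f ⊗ X_1 ⊗ … ⊗ X_n ⊗ B_in, where R has dimension K, each X_i has dimension q, and the marginal of ψ on R is the maximally mixed state (1/K)·Id_K. Suppose that for every partition {1,…,n} = I ∪ J with |I| = n−d+1 and |J| = d−1, S(X_I B_in)_ψ = S(R)_ψ + S(A_f)_ψ + S(X_J)_ψ. Then log K ≤ ℓ, where ℓ := S(B_in)_ψ − S(A_f)_ψ. -/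
open scoped BigOperators ComplexOrder

/-- Von Neumann entropy of a matrix: `-∑ λ_j log λ_j` over the eigenvalues,
if the matrix is Hermitian (else junk value 0). Natural logarithm,
with the convention `0 * log 0 = 0` (automatic since `Real.log 0 = 0`). -/
noncomputable def vnEntropy {m : Type*} [Fintype m] [DecidableEq m]
    (ρ : Matrix m m ℂ) : ℝ :=
  if h : ρ.IsHermitian then
    -∑ j, h.eigenvalues j * Real.log (h.eigenvalues j)
  else 0

/-- Marginal (partial trace) of a state on the composite system
`⨂_{i : ι} X_i` (with `X_i = ℂ^{dim i}`), keeping the factors in `S`. -/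
noncomputable def marginal {ι : Type*} [Fintype ι] [DecidableEq ι]
    {dim : ι → ℕ}
    (ρ : Matrix ((i : ι) → Fin (dim i)) ((i : ι) → Fin (dim i)) ℂ)
    (S : Finset ι) :
    Matrix ((i : {j : ι // j ∈ S}) → Fin (dim i.1))
           ((i : {j : ι // j ∈ S}) → Fin (dim i.1)) ℂ :=
  fun x y =>
    ∑ z : (i : {j : ι // j ∉ S}) → Fin (dim i.1),
      ρ (fun i => if h : i ∈ S then x ⟨i, h⟩ else z ⟨i, h⟩)
        (fun i => if h : i ∈ S then y ⟨i, h⟩ else z ⟨i, h⟩)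

/-- Entropy of the marginal of `ρ` on the factors in `S`. -/
noncomputable def mEnt {ι : Type*} [Fintype ι] [DecidableEq ι]
    {dim : ι → ℕ}
    (ρ : Matrix ((i : ι) → Fin (dim i)) ((i : ι) → Fin (dim i)) ℂ)
    (S : Finset ι) : ℝ :=
  vnEntropy (marginal ρ S)



open Matrix Finset in
theorem ent_of_hermitian {m : Type*} [Fintype m] [DecidableEq m] {A : Matrix m m ℂ}
    (h : A.IsHermitian) :
    vnEntropy A = -(A.charpoly.roots.map (fun z : ℂ => z.re * Real.log z.re)).sum := by
  rw [vnEntropy, dif_pos h, h.roots_charpoly_eq_eigenvalues, Multiset.map_map]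
  simp

open Matrix in
theorem ent_congr_charpoly {m n : Type*} [Fintype m] [DecidableEq m] [Fintype n] [DecidableEq n]
    {A : Matrix m m ℂ} {B : Matrix n n ℂ}
    (hA : A.IsHermitian) (hB : B.IsHermitian) (h : A.charpoly = B.charpoly) :
    vnEntropy A = vnEntropy B := by
  rw [ent_of_hermitian hA, ent_of_hermitian hB, h]

open Matrix in
theorem ent_mul_comm {m n : Type*} [Fintype m] [DecidableEq m] [Fintype n] [DecidableEq n]
    (V : Matrix m n ℂ) : vnEntropy (V * Vᴴ) = vnEntropy (Vᴴ * V) := by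
  rw [ent_of_hermitian (isHermitian_mul_conjTranspose_self V),
    ent_of_hermitian (isHermitian_conjTranspose_mul_self V)]
  have h := Matrix.charpoly_mul_comm' V Vᴴ
  have h2 := congrArg (fun p : Polynomial ℂ =>
    (p.roots.map (fun z : ℂ => z.re * Real.log z.re)).sum) h
  have e1 : (Polynomial.X ^ Fintype.card n * (V * Vᴴ).charpoly : Polynomial ℂ) ≠ 0 :=
    mul_ne_zero (pow_ne_zero _ Polynomial.X_ne_zero) (Matrix.charpoly_monic _).ne_zero
  have e2 : (Polynomial.X ^ Fintype.card m * (Vᴴ * V).charpoly : Polynomial ℂ) ≠ 0 :=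
    mul_ne_zero (pow_ne_zero _ Polynomial.X_ne_zero) (Matrix.charpoly_monic _).ne_zero
  simp only [Polynomial.roots_mul e1, Polynomial.roots_mul e2, Polynomial.roots_X_pow] at h2
  simp [Multiset.map_nsmul, Multiset.sum_nsmul] at h2
  rw [h2]

open Matrix in
theorem ent_of_diag {m : Type*} [Fintype m] [DecidableEq m] (U : Matrix m m ℂ) (hU : Uᴴ * U = 1)
    (p : m → ℝ) : vnEntropy (U * diagonal (fun i => (p i : ℂ)) * Uᴴ)
      = -∑ i, p i * Real.log (p i) := by
  have hh : (U * diagonal (fun i => (p i : ℂ)) * Uᴴ).IsHermitian := by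
    apply isHermitian_mul_mul_conjTranspose
    ext i j
    by_cases h : i = j
    · subst h; simp
    · simp [h, Ne.symm h]
  rw [ent_of_hermitian hh, mul_assoc, Matrix.charpoly_mul_comm, mul_assoc, hU, mul_one,
    Matrix.charpoly_diagonal, Polynomial.roots_prod]
  · simp
  · simp [Finset.prod_ne_zero_iff, Polynomial.X_sub_C_ne_zero]

open Matrix in
theorem exists_spec {m : Type*} [Fintype m] [DecidableEq m] {A : Matrix m m ℂ}
    (h : A.PosSemidef) (ht : A.trace = 1) : ∃ (U : Matrix m m ℂ) (p : m → ℝ),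
      Uᴴ * U = 1 ∧ U * Uᴴ = 1 ∧ A = U * diagonal (fun i => (p i : ℂ)) * Uᴴ ∧ (∀ i, 0 ≤ p i) ∧
      ∑ i, p i = 1 ∧ vnEntropy A = -∑ i, p i * Real.log (p i) := by
  refine ⟨h.1.eigenvectorUnitary, h.1.eigenvalues, ?_, ?_, ?_, h.eigenvalues_nonneg, ?_, ?_⟩
  · simpa [star_eq_conjTranspose] using Unitary.coe_star_mul_self h.1.eigenvectorUnitary
  · simpa [star_eq_conjTranspose] using Unitary.coe_mul_star_self h.1.eigenvectorUnitary
  · exact h.1.spectral_theorem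
  · have := h.1.trace_eq_sum_eigenvalues
    rw [ht] at this
    have h2 := congrArg Complex.re this
    simpa using h2.symm
  · rw [vnEntropy, dif_pos h.1]

theorem klein_scalar {p r : ℝ} (hp : 0 ≤ p) (hr : 0 < r) :
    0 ≤ p * Real.log p - p * Real.log r - p + r ∧
    (p * Real.log p - p * Real.log r - p + r = 0 → p = r) := by
  rcases hp.eq_or_lt with rfl | hp
  · simp [hr.le]
    intro h; linarith
  · have h1 : Real.log (r / p) = Real.log r - Real.log p := Real.log_div hr.ne' hp.ne'
    have key : p * Real.log p - p * Real.log r - p + r = p * (r / p - 1 - Real.log (r / p)) := by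
      rw [h1]; field_simp; ring
    rw [key]
    have h2 := Real.log_le_sub_one_of_pos (div_pos hr hp)
    refine ⟨mul_nonneg hp.le (by linarith), fun h => ?_⟩
    by_contra hne
    have h3 := Real.log_lt_sub_one_of_pos (div_pos hr hp) (by
      intro h; rw [div_eq_one_iff_eq hp.ne'] at h; exact hne h.symm)
    have := mul_pos hp (show 0 < r / p - 1 - Real.log (r / p) by linarith)
    linarith

/-- Klein's inequality in coordinates, with equality case. -/
theorem klein {m k : Type*} [Fintype m] [Fintype k] (w : m → k → ℝ) (hw : ∀ a i, 0 ≤ w a i)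
    (hrow : ∀ a, ∑ i, w a i = 1) (hcol : ∀ i, ∑ a, w a i = 1)
    (p : k → ℝ) (r : m → ℝ) (hp : ∀ i, 0 ≤ p i) (hr : ∀ a, 0 ≤ r a)
    (hsum : ∑ i, p i = ∑ a, r a) (h0 : ∀ a, r a = 0 → ∑ i, w a i * p i = 0) :
    ∑ a, (∑ i, w a i * p i) * Real.log (r a) ≤ ∑ i, p i * Real.log (p i) ∧
    (∑ a, (∑ i, w a i * p i) * Real.log (r a) = ∑ i, p i * Real.log (p i) →
      ∀ a i, w a i ≠ 0 → p i = r a) := by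
  set T : m → k → ℝ := fun a i =>
    w a i * (p i * Real.log (p i) - p i * Real.log (r a) - p i + r a) with hT
  have hz : ∀ a, r a = 0 → ∀ i, w a i * p i = 0 := fun a ha i =>
    (Finset.sum_eq_zero_iff_of_nonneg (fun i _ => mul_nonneg (hw a i) (hp i))).1 (h0 a ha) i
      (Finset.mem_univ _)
  have hTn : ∀ a i, 0 ≤ T a i := by
    intro a i
    rcases (hr a).eq_or_lt with h | h
    · have := hz a h.symm i
      have e : T a i = (w a i * p i) * (Real.log (p i) - Real.log (r a) - 1) + w a i * r a := by
        simp only [hT]; ring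
      rw [e, this, ← h]; simp
    · exact mul_nonneg (hw a i) (klein_scalar (hp i) h).1
  have hTs : ∑ a, ∑ i, T a i = ∑ i, p i * Real.log (p i)
      - ∑ a, (∑ i, w a i * p i) * Real.log (r a) := by
    have e : ∀ a i, T a i = w a i * (p i * Real.log (p i)) - w a i * p i * Real.log (r a)
        - w a i * p i + w a i * r a := by intro a i; simp only [hT]; ring
    simp only [e, Finset.sum_add_distrib, Finset.sum_sub_distrib]
    have e1 : ∑ a, ∑ i, w a i * (p i * Real.log (p i)) = ∑ i, p i * Real.log (p i) := by
      rw [Finset.sum_comm]; simp [← Finset.sum_mul, hcol]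
    have e2 : ∑ a, ∑ i, w a i * p i = ∑ i, p i := by
      rw [Finset.sum_comm]; simp [← Finset.sum_mul, hcol]
    have e3 : ∑ a, ∑ i, w a i * r a = ∑ a, r a := by simp [← Finset.sum_mul, hrow]
    rw [e1, e2, e3, hsum]; simp only [Finset.sum_mul]; ring
  have hn : 0 ≤ ∑ a, ∑ i, T a i := Finset.sum_nonneg fun a _ => Finset.sum_nonneg fun i _ => hTn a i
  refine ⟨by linarith, fun heq a i hne => ?_⟩
  have hTz : T a i = 0 := by
    have : ∑ a, ∑ i, T a i = 0 := by rw [hTs, heq]; ring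
    have h1 := (Finset.sum_eq_zero_iff_of_nonneg
      (fun a _ => Finset.sum_nonneg fun i _ => hTn a i)).1 this a (Finset.mem_univ _)
    exact (Finset.sum_eq_zero_iff_of_nonneg (fun i _ => hTn a i)).1 h1 i (Finset.mem_univ _)
  rcases (hr a).eq_or_lt with h | h
  · have := hz a h.symm i
    rw [← h]; exact (mul_eq_zero.1 this).resolve_left hne
  · exact (klein_scalar (hp i) h).2 ((mul_eq_zero.1 hTz).resolve_left hne)

/-- partial traces -/
def trR {m n : Type*} [Fintype n] (ρ : Matrix (m × n) (m × n) ℂ) : Matrix m m ℂ :=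
  fun x y => ∑ z, ρ (x, z) (y, z)

def trL {m n : Type*} [Fintype m] (ρ : Matrix (m × n) (m × n) ℂ) : Matrix n n ℂ :=
  fun x y => ∑ z, ρ (z, x) (z, y)

open Matrix Kronecker in
theorem trR_conj {m n : Type*} [Fintype m] [Fintype n] [DecidableEq n]
    (ρ : Matrix (m × n) (m × n) ℂ) (A B : Matrix m m ℂ) (C D : Matrix n n ℂ) (h : D * C = 1) :
    trR ((A ⊗ₖ C) * ρ * (B ⊗ₖ D)) = A * trR ρ * B := by
  ext x y
  simp only [trR, mul_apply, kroneckerMap_apply, Fintype.sum_prod_type, Finset.sum_mul,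
    Finset.mul_sum]
  have hd : ∀ b b', ∑ z, D b z * C z b' = if b = b' then 1 else 0 := by
    intro b b'; have := congrFun (congrFun h b) b'
    rwa [mul_apply, one_apply] at this
  rw [Finset.sum_comm]
  refine Finset.sum_congr rfl fun a' _ => ?_
  calc ∑ z, ∑ b', ∑ a, ∑ b, A x a * C z b * ρ (a, b) (a', b') * (B a' y * D b' z)
      = ∑ a, ∑ b', ∑ b, ∑ z, A x a * ρ (a, b) (a', b') * B a' y * (D b' z * C z b) := by
        rw [Finset.sum_comm]
        refine (Finset.sum_congr rfl fun b' _ => Finset.sum_comm).trans ?_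
        rw [Finset.sum_comm]
        refine Finset.sum_congr rfl fun a _ => Finset.sum_congr rfl fun b' _ => ?_
        rw [Finset.sum_comm]
        refine Finset.sum_congr rfl fun b _ => Finset.sum_congr rfl fun z _ => ?_
        ring
    _ = _ := by
        simp only [← Finset.mul_sum, hd]
        simp

open Matrix Kronecker in
theorem trL_conj {m n : Type*} [Fintype m] [Fintype n] [DecidableEq m]
    (ρ : Matrix (m × n) (m × n) ℂ) (A B : Matrix m m ℂ) (C D : Matrix n n ℂ) (h : B * A = 1) :
    trL ((A ⊗ₖ C) * ρ * (B ⊗ₖ D)) = C * trL ρ * D := by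
  have h1 := trR_conj (ρ.submatrix (Equiv.prodComm n m) (Equiv.prodComm n m)) C D A B h
  have e : ((A ⊗ₖ C) * ρ * (B ⊗ₖ D)).submatrix (Equiv.prodComm n m) (Equiv.prodComm n m)
      = (C ⊗ₖ A) * ρ.submatrix (Equiv.prodComm n m) (Equiv.prodComm n m) * (D ⊗ₖ B) := by
    rw [← Matrix.submatrix_mul_equiv _ _ _ (Equiv.prodComm n m) _,
      ← Matrix.submatrix_mul_equiv _ _ _ (Equiv.prodComm n m) _]
    congr 1
    · congr 1
      ext ⟨a, b⟩ ⟨c, d⟩; simp [mul_comm]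
    · ext ⟨a, b⟩ ⟨c, d⟩; simp [mul_comm]
  rw [← e] at h1
  exact h1

open Matrix in
theorem diag_entry {m : Type*} [Fintype m] [DecidableEq m] (U : Matrix m m ℂ) (p : m → ℝ) (a : m) :
    (U * diagonal (fun i => (p i : ℂ)) * Uᴴ) a a
      = ((∑ i, Complex.normSq (U a i) * p i : ℝ) : ℂ) := by
  rw [mul_apply]
  push_cast
  refine Finset.sum_congr rfl fun i _ => ?_
  rw [mul_diagonal, conjTranspose_apply, Complex.normSq_eq_conj_mul_self, Complex.star_def]
  ring

open Matrix in
theorem row_normSq {m : Type*} [Fintype m] [DecidableEq m] (U : Matrix m m ℂ) (h : U * Uᴴ = 1)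
    (a : m) : ∑ i, Complex.normSq (U a i) = 1 := by
  have := diag_entry U (fun _ => 1) a
  simp only [Complex.ofReal_one, mul_one] at this
  have e : (diagonal (fun _ => 1) : Matrix m m ℂ) = 1 := rfl
  rw [e, mul_one, h, one_apply_eq] at this
  exact_mod_cast this.symm

open Matrix Kronecker in
theorem subadd {m n : Type*} [Fintype m] [DecidableEq m] [Fintype n] [DecidableEq n]
    (ρ : Matrix (m × n) (m × n) ℂ) (hρ : ρ.PosSemidef) (ht : ρ.trace = 1)
    (hA : (trR ρ).PosSemidef) (hB : (trL ρ).PosSemidef) :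
    vnEntropy ρ ≤ vnEntropy (trR ρ) + vnEntropy (trL ρ) ∧
    (vnEntropy ρ = vnEntropy (trR ρ) + vnEntropy (trL ρ) → ρ = trR ρ ⊗ₖ trL ρ) := by
  have htA : (trR ρ).trace = 1 := by
    rw [← ht]; simp [Matrix.trace, trR, Fintype.sum_prod_type]
  have htB : (trL ρ).trace = 1 := by
    rw [← ht]; simp [Matrix.trace, trL, Fintype.sum_prod_type]; exact Finset.sum_comm
  obtain ⟨E, p, hE1, hE2, hEd, hp, hp1, hpe⟩ := exists_spec hρ ht
  obtain ⟨W, s, hW1, hW2, hWd, hs, hs1, hse⟩ := exists_spec hA htA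
  obtain ⟨Z, t, hZ1, hZ2, hZd, ht', ht1, hte⟩ := exists_spec hB htB
  set G := W ⊗ₖ Z with hG
  have hG1 : Gᴴ * G = 1 := by
    rw [hG, conjTranspose_kronecker, ← mul_kronecker_mul, hW1, hZ1, one_kronecker_one]
  have hG2 : G * Gᴴ = 1 := by
    rw [hG, conjTranspose_kronecker, ← mul_kronecker_mul, hW2, hZ2, one_kronecker_one]
  set U := Gᴴ * E with hU
  have hU2 : U * Uᴴ = 1 := by
    rw [hU, conjTranspose_mul, conjTranspose_conjTranspose, ← mul_assoc, mul_assoc Gᴴ, hE2, mul_one, hG1]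
  have hU1 : Uᴴ * U = 1 := by
    rw [hU, conjTranspose_mul, conjTranspose_conjTranspose, ← mul_assoc, mul_assoc Eᴴ, hG2, mul_one, hE1]
  set M := Gᴴ * ρ * G with hM
  have hMU : M = U * diagonal (fun i => (p i : ℂ)) * Uᴴ := by
    rw [hM, hEd, hU, conjTranspose_mul, conjTranspose_conjTranspose]
    simp only [mul_assoc]
  set D : m × n → ℝ := fun a => ∑ i, Complex.normSq (U a i) * p i with hD
  have hMD : ∀ a, M a a = (D a : ℂ) := fun a => by rw [hMU]; exact diag_entry U p a
  have hMR : trR M = diagonal (fun i => (s i : ℂ)) := by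
    rw [hM, hG, conjTranspose_kronecker, trR_conj _ _ _ _ _ hZ2, hWd]
    simp only [mul_assoc]; rw [hW1, mul_one, ← mul_assoc, hW1, one_mul]
  have hML : trL M = diagonal (fun i => (t i : ℂ)) := by
    rw [hM, hG, conjTranspose_kronecker, trL_conj _ _ _ _ _ hW2, hZd]
    simp only [mul_assoc]; rw [hZ1, mul_one, ← mul_assoc, hZ1, one_mul]
  have hDs : ∀ j, ∑ k, D (j, k) = s j := by
    intro j
    have := congrFun (congrFun hMR j) j
    simp only [trR, hMD, diagonal_apply_eq] at this
    exact_mod_cast this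
  have hDt : ∀ k, ∑ j, D (j, k) = t k := by
    intro k
    have := congrFun (congrFun hML k) k
    simp only [trL, hMD, diagonal_apply_eq] at this
    exact_mod_cast this
  have hDn : ∀ a, 0 ≤ D a := fun a =>
    Finset.sum_nonneg fun i _ => mul_nonneg (Complex.normSq_nonneg _) (hp i)
  have hDs0 : ∀ j k, s j = 0 → D (j, k) = 0 := by
    intro j k h
    exact (Finset.sum_eq_zero_iff_of_nonneg (fun k _ => hDn (j, k))).1 ((hDs j).trans h) k
      (Finset.mem_univ _)
  have hDt0 : ∀ j k, t k = 0 → D (j, k) = 0 := by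
    intro j k h
    exact (Finset.sum_eq_zero_iff_of_nonneg (fun j _ => hDn (j, k))).1 ((hDt k).trans h) j
      (Finset.mem_univ _)
  have hcol : ∀ i, ∑ a, Complex.normSq (U a i) = 1 := by
    intro i
    have := row_normSq Uᴴ (by rw [conjTranspose_conjTranspose]; exact hU1) i
    simpa [conjTranspose_apply] using this
  have hk := klein (fun a i => Complex.normSq (U a i)) (fun _ _ => Complex.normSq_nonneg _)
    (row_normSq U hU2) hcol p (fun a => s a.1 * t a.2) hp (fun a => mul_nonneg (hs _) (ht' _))
    (by rw [hp1, Fintype.sum_prod_type]; simp [← Finset.mul_sum, ht1, hs1])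
    (by
      rintro ⟨j, k⟩ h
      rcases mul_eq_zero.1 h with h | h
      · exact hDs0 j k h
      · exact hDt0 j k h)
  have hlog : ∑ a, D a * Real.log (s a.1 * t a.2)
      = ∑ j, s j * Real.log (s j) + ∑ k, t k * Real.log (t k) := by
    have e : ∀ j k, D (j, k) * Real.log (s j * t k)
        = D (j, k) * Real.log (s j) + D (j, k) * Real.log (t k) := by
      intro j k
      by_cases h1 : s j = 0
      · simp [hDs0 j k h1]
      by_cases h2 : t k = 0
      · simp [hDt0 j k h2]
      rw [Real.log_mul h1 h2]; ring
    rw [Fintype.sum_prod_type]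
    simp only [e, Finset.sum_add_distrib]
    congr 1
    · simp only [← Finset.sum_mul, hDs]
    · rw [Finset.sum_comm]; simp only [← Finset.sum_mul, hDt]
  change ∑ a, D a * Real.log (s a.1 * t a.2) ≤ _ ∧
    (∑ a, D a * Real.log (s a.1 * t a.2) = _ → _) at hk
  rw [hlog] at hk
  rw [hpe, hse, hte]
  refine ⟨by linarith [hk.1], fun heq => ?_⟩
  have h3 := hk.2 (by linarith)
  have hcomm : U * diagonal (fun i => (p i : ℂ))
      = diagonal (fun a : m × n => ((s a.1 * t a.2 : ℝ) : ℂ)) * U := by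
    ext a i
    rw [mul_diagonal, diagonal_mul]
    by_cases h : U a i = 0
    · simp [h]
    · rw [h3 a i (by simpa using h), mul_comm]
  have hMd : M = diagonal (fun a : m × n => ((s a.1 * t a.2 : ℝ) : ℂ)) := by
    rw [hMU, hcomm, mul_assoc, hU2, mul_one]
  have hkr : diagonal (fun a : m × n => ((s a.1 * t a.2 : ℝ) : ℂ))
      = diagonal (fun i => (s i : ℂ)) ⊗ₖ diagonal (fun i => (t i : ℂ)) := by
    rw [diagonal_kronecker_diagonal]; simp
  have hρM : ρ = G * M * Gᴴ := by
    rw [hM]; simp only [mul_assoc]; rw [hG2, mul_one, ← mul_assoc, hG2, one_mul]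
  refine hρM.trans ?_
  rw [hMd, hkr, hG, conjTranspose_kronecker, ← mul_kronecker_mul, ← mul_kronecker_mul,
    ← hWd, ← hZd]

open Matrix Kronecker in
theorem ent_kron {m n : Type*} [Fintype m] [DecidableEq m] [Fintype n] [DecidableEq n]
    (A : Matrix m m ℂ) (B : Matrix n n ℂ) (hA : A.PosSemidef) (hB : B.PosSemidef)
    (htA : A.trace = 1) (htB : B.trace = 1) :
    vnEntropy (A ⊗ₖ B) = vnEntropy A + vnEntropy B := by
  obtain ⟨W, s, hW1, hW2, hWd, hs, hs1, hse⟩ := exists_spec hA htA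
  obtain ⟨Z, t, hZ1, hZ2, hZd, ht', ht1, hte⟩ := exists_spec hB htB
  have e : A ⊗ₖ B = (W ⊗ₖ Z) * diagonal (fun a : m × n => ((s a.1 * t a.2 : ℝ) : ℂ)) * (W ⊗ₖ Z)ᴴ := by
    have hkr : diagonal (fun a : m × n => ((s a.1 * t a.2 : ℝ) : ℂ))
        = diagonal (fun i => (s i : ℂ)) ⊗ₖ diagonal (fun i => (t i : ℂ)) := by
      rw [diagonal_kronecker_diagonal]; simp
    rw [hkr, conjTranspose_kronecker, ← mul_kronecker_mul, ← mul_kronecker_mul, ← hWd, ← hZd]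
  rw [hse, hte, e, ent_of_diag _ (by
    rw [conjTranspose_kronecker, ← mul_kronecker_mul, hW1, hZ1, one_kronecker_one])]
  have e2 : ∀ j k, s j * t k * Real.log (s j * t k)
      = t k * (s j * Real.log (s j)) + s j * (t k * Real.log (t k)) := by
    intro j k
    by_cases h1 : s j = 0
    · simp [h1]
    by_cases h2 : t k = 0
    · simp [h2]
    rw [Real.log_mul h1 h2]; ring
  rw [Fintype.sum_prod_type]
  simp only [e2, Finset.sum_add_distrib, ← Finset.sum_mul, ← Finset.mul_sum, ht1, hs1, one_mul]
  ring

abbrev Cfg {ι : Type*} (dim : ι → ℕ) (S : Finset ι) : Type _ :=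
  (i : {j : ι // j ∈ S}) → Fin (dim i.1)

def glue {ι : Type*} [DecidableEq ι] {dim : ι → ℕ} {U S T : Finset ι}
    (h : ∀ i, i ∈ U ↔ i ∈ S ∨ i ∈ T) (x : Cfg dim S) (y : Cfg dim T) : Cfg dim U :=
  fun i => if hi : i.1 ∈ S then x ⟨i.1, hi⟩ else y ⟨i.1, ((h i.1).1 i.2).resolve_left hi⟩

def glueEquiv {ι : Type*} [DecidableEq ι] {dim : ι → ℕ} {U S T : Finset ι}
    (h : ∀ i, i ∈ U ↔ i ∈ S ∨ i ∈ T) (hd : ∀ i ∈ S, i ∉ T) :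
    Cfg dim S × Cfg dim T ≃ Cfg dim U where
  toFun x := glue h x.1 x.2
  invFun u := (fun i => u ⟨i.1, (h i.1).2 (Or.inl i.2)⟩, fun i => u ⟨i.1, (h i.1).2 (Or.inr i.2)⟩)
  left_inv := by
    rintro ⟨x, y⟩
    ext i
    · simp [glue, i.2]
    · have : i.1 ∉ S := fun hs => hd _ hs i.2
      simp [glue, this]
  right_inv := by
    intro u
    funext i
    simp [glue]

theorem glue_symm {ι : Type*} [DecidableEq ι] {dim : ι → ℕ} {U S T : Finset ι}
    (h : ∀ i, i ∈ U ↔ i ∈ S ∨ i ∈ T) (h' : ∀ i, i ∈ U ↔ i ∈ T ∨ i ∈ S) (hd : ∀ i ∈ S, i ∉ T)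
    (x : Cfg dim S) (y : Cfg dim T) : glue h x y = glue h' y x := by
  funext i
  unfold glue
  by_cases h1 : i.1 ∈ S
  · have h2 := hd _ h1
    simp [h1, h2]
  · have h2 := ((h i.1).1 i.2).resolve_left h1
    simp [h1, h2]

/-- splitting the configurations outside `S` -/
def outEquiv {ι : Type*} [DecidableEq ι] (dim : ι → ℕ) {U S T : Finset ι}
    (h : ∀ i, i ∈ U ↔ i ∈ S ∨ i ∈ T) (hd : ∀ i ∈ S, i ∉ T) :
    ((i : {j : ι // j ∉ S}) → Fin (dim i.1)) ≃
      Cfg dim T × ((i : {j : ι // j ∉ U}) → Fin (dim i.1)) where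
  toFun u := (fun i => u ⟨i.1, fun hs => hd _ hs i.2⟩,
    fun i => u ⟨i.1, fun hs => i.2 ((h i.1).2 (Or.inl hs))⟩)
  invFun z := fun i => if hi : i.1 ∈ T then z.1 ⟨i.1, hi⟩ else
    z.2 ⟨i.1, fun hu => ((h i.1).1 hu).elim i.2 hi⟩
  left_inv := by
    intro u
    funext i
    by_cases hi : i.1 ∈ T <;> simp [hi]
  right_inv := by
    rintro ⟨x, y⟩
    ext i
    · simp
    · have : i.1 ∉ T := fun ht => i.2 ((h i.1).2 (Or.inr ht))
      simp [this]

theorem marg_left {ι : Type*} [Fintype ι] [DecidableEq ι] {dim : ι → ℕ}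
    (ρ : Matrix ((i : ι) → Fin (dim i)) ((i : ι) → Fin (dim i)) ℂ) {U S T : Finset ι}
    (h : ∀ i, i ∈ U ↔ i ∈ S ∨ i ∈ T) (hd : ∀ i ∈ S, i ∉ T) (x y : Cfg dim S) :
    marginal ρ S x y = ∑ z : Cfg dim T, marginal ρ U (glue h x z) (glue h y z) := by
  unfold marginal
  rw [← Fintype.sum_prod_type' (f := fun (z : Cfg dim T) (w : (i : {j : ι // j ∉ U}) → Fin (dim i.1)) =>
    ρ (fun i => if hi : i ∈ U then glue h x z ⟨i, hi⟩ else w ⟨i, hi⟩)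
      (fun i => if hi : i ∈ U then glue h y z ⟨i, hi⟩ else w ⟨i, hi⟩))]
  refine Fintype.sum_equiv (outEquiv dim h hd) _ _ fun u => ?_
  have key : ∀ x : Cfg dim S, (fun i => if h : i ∈ S then x ⟨i, h⟩ else u ⟨i, h⟩ : (i : ι) → Fin (dim i))
      = (fun i => if hi : i ∈ U then glue h x (outEquiv dim h hd u).1 ⟨i, hi⟩
          else (outEquiv dim h hd u).2 ⟨i, hi⟩) := by
    intro x
    funext i
    by_cases h1 : i ∈ S
    · have h2 : i ∈ U := (h i).2 (Or.inl h1)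
      simp [glue, h1, h2]
    · by_cases h2 : i ∈ U
      · simp [glue, h1, h2, outEquiv]
      · simp [h1, h2, outEquiv]
  rw [key, key]

theorem marg_right {ι : Type*} [Fintype ι] [DecidableEq ι] {dim : ι → ℕ}
    (ρ : Matrix ((i : ι) → Fin (dim i)) ((i : ι) → Fin (dim i)) ℂ) {U S T : Finset ι}
    (h : ∀ i, i ∈ U ↔ i ∈ S ∨ i ∈ T) (hd : ∀ i ∈ S, i ∉ T) (x y : Cfg dim T) :
    marginal ρ T x y = ∑ z : Cfg dim S, marginal ρ U (glue h z x) (glue h z y) := by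
  have h' : ∀ i, i ∈ U ↔ i ∈ T ∨ i ∈ S := fun i => (h i).trans or_comm
  rw [marg_left ρ h' (fun i ht hs => hd i hs ht)]
  simp only [glue_symm h h' hd]

theorem marg_trace {ι : Type*} [Fintype ι] [DecidableEq ι] {dim : ι → ℕ}
    (ρ : Matrix ((i : ι) → Fin (dim i)) ((i : ι) → Fin (dim i)) ℂ) (S : Finset ι) :
    (marginal ρ S).trace = ρ.trace := by
  unfold Matrix.trace Matrix.diag marginal
  rw [← Fintype.sum_prod_type' (f := fun (x : Cfg dim S) (z : (i : {j : ι // j ∉ S}) → Fin (dim i.1)) =>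
    ρ (fun i => if hi : i ∈ S then x ⟨i, hi⟩ else z ⟨i, hi⟩)
      (fun i => if hi : i ∈ S then x ⟨i, hi⟩ else z ⟨i, hi⟩))]
  exact Fintype.sum_equiv (Equiv.piEquivPiSubtypeProd (fun i => i ∈ S) (fun i => Fin (dim i))).symm
    _ _ fun u => rfl

/-- amplitude matrix of a pure state across a cut -/
def amp {ι : Type*} [DecidableEq ι] {dim : ι → ℕ} (v : ((i : ι) → Fin (dim i)) → ℂ)
    (S : Finset ι) : Matrix (Cfg dim S) ((i : {j : ι // j ∉ S}) → Fin (dim i.1)) ℂ :=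
  fun x z => v (fun i => if hi : i ∈ S then x ⟨i, hi⟩ else z ⟨i, hi⟩)

open Matrix in
theorem marg_amp {ι : Type*} [Fintype ι] [DecidableEq ι] {dim : ι → ℕ}
    (ρ : Matrix ((i : ι) → Fin (dim i)) ((i : ι) → Fin (dim i)) ℂ)
    (v : ((i : ι) → Fin (dim i)) → ℂ) (hv : ∀ x y, ρ x y = v x * star (v y)) (S : Finset ι) :
    marginal ρ S = amp v S * (amp v S)ᴴ := by
  ext x y
  simp only [marginal, hv, mul_apply, conjTranspose_apply, amp]

open Matrix in
theorem marg_psd {ι : Type*} [Fintype ι] [DecidableEq ι] {dim : ι → ℕ}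
    (ρ : Matrix ((i : ι) → Fin (dim i)) ((i : ι) → Fin (dim i)) ℂ)
    (v : ((i : ι) → Fin (dim i)) → ℂ) (hv : ∀ x y, ρ x y = v x * star (v y)) (S : Finset ι) :
    (marginal ρ S).PosSemidef := by
  rw [marg_amp ρ v hv]; exact posSemidef_self_mul_conjTranspose _

open Matrix in
theorem ent_submatrix {m n : Type*} [Fintype m] [DecidableEq m] [Fintype n] [DecidableEq n]
    {A : Matrix m m ℂ} (hA : A.IsHermitian) (e : n ≃ m) :
    vnEntropy (A.submatrix e e) = vnEntropy A := by
  apply ent_congr_charpoly (hA.submatrix e) hA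
  exact Matrix.charpoly_reindex e.symm A

open Matrix in
theorem mEnt_compl {ι : Type*} [Fintype ι] [DecidableEq ι] {dim : ι → ℕ}
    (ρ : Matrix ((i : ι) → Fin (dim i)) ((i : ι) → Fin (dim i)) ℂ)
    (v : ((i : ι) → Fin (dim i)) → ℂ) (hv : ∀ x y, ρ x y = v x * star (v y)) (S T : Finset ι)
    (h : ∀ i, i ∈ T ↔ i ∉ S) : mEnt ρ S = mEnt ρ T := by
  let e : Cfg dim T ≃ ((i : {j : ι // j ∉ S}) → Fin (dim i.1)) :=
    { toFun := fun u i => u ⟨i.1, (h i.1).2 i.2⟩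
      invFun := fun u i => u ⟨i.1, (h i.1).1 i.2⟩
      left_inv := fun u => rfl
      right_inv := fun u => rfl }
  let f : ((i : {j : ι // j ∉ T}) → Fin (dim i.1)) ≃ Cfg dim S :=
    { toFun := fun u i => u ⟨i.1, fun ht => (h i.1).1 ht i.2⟩
      invFun := fun u i => u ⟨i.1, by_contra fun hs => i.2 ((h i.1).2 hs)⟩
      left_inv := fun u => rfl
      right_inv := fun u => rfl }
  have hamp : amp v T = ((amp v S)ᵀ).submatrix e f := by
    ext x z
    simp only [amp, submatrix_apply, transpose_apply]
    congr 1
    funext i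
    by_cases hi : i ∈ S
    · have : i ∉ T := fun ht => (h i).1 ht hi
      simp [hi, this, f]
    · have : i ∈ T := (h i).2 hi
      simp [hi, this, e]
  have hm : marginal ρ T = (((amp v S)ᴴ * amp v S)ᵀ).submatrix e e := by
    rw [marg_amp ρ v hv, hamp, transpose_mul, conjTranspose_submatrix,
      Matrix.submatrix_mul_equiv]
    rfl
  have hH := isHermitian_conjTranspose_mul_self (amp v S)
  rw [mEnt, mEnt, hm, ent_submatrix hH.transpose, marg_amp ρ v hv, ent_mul_comm]
  exact ent_congr_charpoly hH hH.transpose (Matrix.charpoly_transpose _).symm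

open Matrix Kronecker in
theorem mEnt_subadd {ι : Type*} [Fintype ι] [DecidableEq ι] {dim : ι → ℕ}
    (ρ : Matrix ((i : ι) → Fin (dim i)) ((i : ι) → Fin (dim i)) ℂ) (htr : ρ.trace = 1)
    (v : ((i : ι) → Fin (dim i)) → ℂ) (hv : ∀ x y, ρ x y = v x * star (v y)) {U S T : Finset ι}
    (h : ∀ i, i ∈ U ↔ i ∈ S ∨ i ∈ T) (hd : ∀ i ∈ S, i ∉ T) :
    mEnt ρ U ≤ mEnt ρ S + mEnt ρ T ∧
    (mEnt ρ U = mEnt ρ S + mEnt ρ T → ∀ x y z w,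
      marginal ρ U (glue h x z) (glue h y w) = marginal ρ S x y * marginal ρ T z w) := by
  have hU := marg_psd ρ v hv U
  set σ := (marginal ρ U).submatrix (glueEquiv h hd) (glueEquiv h hd) with hσ
  have e1 : trR σ = marginal ρ S := by
    ext x y; rw [marg_left ρ h hd]; rfl
  have e2 : trL σ = marginal ρ T := by
    ext x y; rw [marg_right ρ h hd]; rfl
  have ht : σ.trace = 1 := by
    rw [← htr, ← marg_trace ρ U]
    exact Fintype.sum_equiv (glueEquiv h hd) _ _ fun _ => rfl
  have key := subadd σ (hU.submatrix _) ht (by rw [e1]; exact marg_psd ρ v hv S)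
    (by rw [e2]; exact marg_psd ρ v hv T)
  rw [e1, e2, hσ, ent_submatrix hU.1] at key
  refine ⟨key.1, fun heq x y z w => ?_⟩
  exact congrFun (congrFun (key.2 heq) (x, z)) (y, w)

open Matrix Kronecker in
theorem mEnt_prod {ι : Type*} [Fintype ι] [DecidableEq ι] {dim : ι → ℕ}
    (ρ : Matrix ((i : ι) → Fin (dim i)) ((i : ι) → Fin (dim i)) ℂ) (htr : ρ.trace = 1)
    (v : ((i : ι) → Fin (dim i)) → ℂ) (hv : ∀ x y, ρ x y = v x * star (v y)) {U S T : Finset ι}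
    (h : ∀ i, i ∈ U ↔ i ∈ S ∨ i ∈ T) (hd : ∀ i ∈ S, i ∉ T)
    (hp : ∀ x y z w,
      marginal ρ U (glue h x z) (glue h y w) = marginal ρ S x y * marginal ρ T z w) :
    mEnt ρ U = mEnt ρ S + mEnt ρ T := by
  have hU := marg_psd ρ v hv U
  rw [mEnt, ← ent_submatrix hU.1 (glueEquiv h hd)]
  have e : (marginal ρ U).submatrix (glueEquiv h hd) (glueEquiv h hd)
      = marginal ρ S ⊗ₖ marginal ρ T := by
    ext ⟨x, z⟩ ⟨y, w⟩
    exact hp x y z w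
  rw [e, ent_kron _ _ (marg_psd ρ v hv S) (marg_psd ρ v hv T) (by rw [marg_trace, htr])
    (by rw [marg_trace, htr])]
  rfl

/-- Product structure is inherited when the second factor is shrunk. -/
theorem prod_shrink {ι : Type*} [Fintype ι] [DecidableEq ι] {dim : ι → ℕ}
    (ρ : Matrix ((i : ι) → Fin (dim i)) ((i : ι) → Fin (dim i)) ℂ) {U S T U' T' : Finset ι}
    (h : ∀ i, i ∈ U ↔ i ∈ S ∨ i ∈ T) (hd : ∀ i ∈ S, i ∉ T)
    (h' : ∀ i, i ∈ U' ↔ i ∈ S ∨ i ∈ T') (hT : T' ⊆ T)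
    (hp : ∀ x y z w,
      marginal ρ U (glue h x z) (glue h y w) = marginal ρ S x y * marginal ρ T z w) (x y z w) :
    marginal ρ U' (glue h' x z) (glue h' y w) = marginal ρ S x y * marginal ρ T' z w := by
  have hT2 : ∀ i, i ∈ T ↔ i ∈ T' ∨ i ∈ T \ T' := by
    intro i
    rw [Finset.mem_sdiff]
    have := @hT i
    tauto
  have hTd : ∀ i ∈ T', i ∉ T \ T' := by
    intro i hi; simp [hi]
  have hU2 : ∀ i, i ∈ U ↔ i ∈ U' ∨ i ∈ T \ T' := by
    intro i
    rw [h, h', hT2 i, or_assoc]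
  have hUd : ∀ i ∈ U', i ∉ T \ T' := by
    intro i hi hi2
    rcases (h' i).1 hi with hs | ht
    · exact hd i hs (Finset.mem_sdiff.1 hi2).1
    · exact hTd i ht hi2
  rw [marg_left ρ hU2 hUd, marg_left ρ hT2 hTd, Finset.mul_sum]
  refine Finset.sum_congr rfl fun u _ => ?_
  rw [← hp]
  have key : ∀ x z, glue hU2 (glue h' x z) u = glue (dim := dim) h x (glue hT2 z u) := by
    intro x z
    funext i
    unfold glue
    by_cases h1 : i.1 ∈ S
    · have : i.1 ∈ U' := (h' _).2 (Or.inl h1)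
      simp [h1, this]
    · by_cases h2 : i.1 ∈ T'
      · have : i.1 ∈ U' := (h' _).2 (Or.inr h2)
        simp [h1, h2, this]
      · have : i.1 ∉ U' := fun hu => ((h' _).1 hu).elim h1 h2
        simp [h1, h2, this]
  rw [key, key]

open Matrix in
theorem pure_vec {m : Type*} [Fintype m] [DecidableEq m] (ψ : Matrix m m ℂ) (h : ψ.PosSemidef)
    (hr : ψ.rank = 1) : ∃ v : m → ℂ, ∀ x y, ψ x y = v x * star (v y) := by
  rw [h.1.rank_eq_card_non_zero_eigs, Fintype.card_eq_one_iff] at hr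
  obtain ⟨⟨i, hi⟩, hu⟩ := hr
  have h0 : ∀ j, j ≠ i → h.1.eigenvalues j = 0 := by
    intro j hj
    by_contra hne
    exact hj (congrArg Subtype.val (hu ⟨j, hne⟩))
  set E : Matrix m m ℂ := h.1.eigenvectorUnitary.1 with hE
  set p := h.1.eigenvalues with hp
  have hs : ψ = E * diagonal (fun i => (p i : ℂ)) * Eᴴ := h.1.spectral_theorem
  refine ⟨fun x => (Real.sqrt (p i) : ℂ) * E x i, fun x y => ?_⟩
  have hsq : ((Real.sqrt (p i) : ℂ)) * (Real.sqrt (p i) : ℂ) = (p i : ℂ) := by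
    rw [← Complex.ofReal_mul, Real.mul_self_sqrt (h.eigenvalues_nonneg i)]
  conv_lhs => rw [hs]
  rw [mul_apply, Finset.sum_eq_single i]
  · rw [mul_diagonal, conjTranspose_apply, ← hsq]
    simp only [star_mul', Complex.star_def, Complex.conj_ofReal]
    ring
  · intro j _ hj
    rw [mul_diagonal, h0 j hj]; simp
  · simp

open Matrix in
theorem ent_maxmix {m : Type*} [Fintype m] [DecidableEq m] (K : ℕ) (hK : 1 ≤ K)
    (hc : Fintype.card m = K) : vnEntropy (((K : ℂ)⁻¹) • (1 : Matrix m m ℂ)) = Real.log K := by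
  have h := ent_of_diag (1 : Matrix m m ℂ) (by simp) (fun _ => (K : ℝ)⁻¹)
  have e : (1 : Matrix m m ℂ) * diagonal (fun _ => (((K : ℝ)⁻¹ : ℝ) : ℂ)) * (1 : Matrix m m ℂ)ᴴ
      = ((K : ℂ)⁻¹) • (1 : Matrix m m ℂ) := by
    rw [smul_one_eq_diagonal]; simp
  rw [e] at h
  rw [h]
  have : (K : ℝ) ≠ 0 := by positivity
  simp [hc, this]

/-- entanglement-assisted quantum Singleton bound, case `2(d-1) ≥ n`:
`log K ≤ ℓ`. Systems: `R = Sum.inr 0`, `A_f = Sum.inr 1`, `B_in = Sum.inr 2`. -/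
theorem ea_singleton_large_distance
    (n d q K : ℕ) (hq : 2 ≤ q) (hK : 1 ≤ K) (hd : 2 ≤ d) (hdn : d ≤ n)
    (hdn2 : n ≤ 2 * (d - 1))
    (dim : Fin n ⊕ Fin 3 → ℕ)
    (hdimX : ∀ i : Fin n, dim (Sum.inl i) = q)
    (hdimR : dim (Sum.inr 0) = K)
    (ψ : Matrix ((i : Fin n ⊕ Fin 3) → Fin (dim i))
                ((i : Fin n ⊕ Fin 3) → Fin (dim i)) ℂ)
    (hpsd : ψ.PosSemidef) (htr : ψ.trace = 1) (hpure : ψ.rank = 1)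
    (hmaxmix : marginal ψ ({Sum.inr 0} : Finset (Fin n ⊕ Fin 3)) = (K : ℂ)⁻¹ • 1)
    (hdec : ∀ I J : Finset (Fin n), Disjoint I J → I ∪ J = Finset.univ →
      I.card = n - d + 1 → J.card = d - 1 →
      mEnt ψ (I.image Sum.inl ∪ ({Sum.inr 2} : Finset (Fin n ⊕ Fin 3))) =
        mEnt ψ ({Sum.inr 0} : Finset (Fin n ⊕ Fin 3)) + mEnt ψ ({Sum.inr 1} : Finset (Fin n ⊕ Fin 3)) + mEnt ψ (J.image Sum.inl)) :
    Real.log K ≤ (mEnt ψ ({Sum.inr 2} : Finset (Fin n ⊕ Fin 3)) - mEnt ψ ({Sum.inr 1} : Finset (Fin n ⊕ Fin 3))) := by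
  obtain ⟨v, hv⟩ := pure_vec ψ hpsd hpure
  have hSR : mEnt ψ ({Sum.inr 0} : Finset (Fin n ⊕ Fin 3)) = Real.log K := by
    rw [mEnt, hmaxmix]
    apply ent_maxmix K hK
    rw [Fintype.card_pi]
    simp [hdimR]
  obtain ⟨I, -, hI⟩ := Finset.exists_subset_card_eq
    (show n - d + 1 ≤ (Finset.univ : Finset (Fin n)).card by simp; omega)
  obtain ⟨J', hIJ, -, hJ'⟩ := Finset.exists_subsuperset_card_eq (Finset.subset_univ I)
    (show I.card ≤ d - 1 by omega) (show d - 1 ≤ (Finset.univ : Finset (Fin n)).card by simp; omega)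
  have h1 := hdec I Iᶜ disjoint_compl_right (Finset.union_compl I) hI
    (by rw [Finset.card_compl, hI, Fintype.card_fin]; omega)
  have h2 := hdec J'ᶜ J' disjoint_compl_left (by rw [Finset.union_comm, Finset.union_compl])
    (by rw [Finset.card_compl, hJ', Fintype.card_fin]; omega) hJ'
  set A : Finset (Fin n ⊕ Fin 3) := {Sum.inr 0, Sum.inr 1} with hA
  have hAJ : ∀ J : Finset (Fin n), ∀ i ∈ A, i ∉ J.image Sum.inl := by
    intro J i hi
    rw [hA] at hi
    simp only [Finset.mem_insert, Finset.mem_singleton] at hi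
    rcases hi with rfl | rfl <;> simp
  have hcomp : ∀ J : Finset (Fin n), ∀ i : Fin n ⊕ Fin 3,
      i ∈ Jᶜ.image Sum.inl ∪ ({Sum.inr 2} : Finset (Fin n ⊕ Fin 3))
        ↔ i ∉ A ∪ J.image Sum.inl := by
    intro J i
    rcases i with i | i
    · simp [hA]
    · fin_cases i <;> simp [hA]
  have hun : ∀ J : Finset (Fin n), ∀ i, i ∈ A ∪ J.image Sum.inl ↔ i ∈ A ∨ i ∈ J.image Sum.inl :=
    fun J i => Finset.mem_union
  -- purity
  have p1 := mEnt_compl ψ v hv _ _ (hcomp J')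
  have p2 := mEnt_compl ψ v hv _ _ (hcomp I)
  -- subadditivity
  have sA := (mEnt_subadd ψ htr v hv (U := A) (S := {Sum.inr 0}) (T := {Sum.inr 1})
    (by intro i; simp [hA]) (by simp)).1
  have sJ := mEnt_subadd ψ htr v hv (hun J') (hAJ J')
  have hRA : mEnt ψ (A ∪ J'.image Sum.inl) = mEnt ψ A + mEnt ψ (J'.image Sum.inl) :=
    le_antisymm sJ.1 (by linarith)
  have hpI := mEnt_prod ψ htr v hv (hun I) (hAJ I) (prod_shrink ψ (hun J') (hAJ J') (hun I)
    (Finset.image_subset_image hIJ) (sJ.2 hRA))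
  have s1 := (mEnt_subadd ψ htr v hv (U := I.image Sum.inl ∪ {Sum.inr 2}) (S := I.image Sum.inl)
    (T := {Sum.inr 2}) (fun i => Finset.mem_union) (by simp)).1
  have s2 := (mEnt_subadd ψ htr v hv (U := Iᶜ.image Sum.inl ∪ {Sum.inr 2}) (S := Iᶜ.image Sum.inl)
    (T := {Sum.inr 2}) (fun i => Finset.mem_union) (by simp)).1
  linarith
end

section
/- Let ρ be a quantum state on a composite system X_1 ⊗ … ⊗ X_n of finite-dimensional systems, and let d be an integer with d ≤ n and 2(d−1) > n. Then S(X_{{1,…,n}})_ρ ≤ E_{|I|=n−d+1} S(X_I)_ρ + ((d−1)/(2d−2−n)) · ( E_{|J|=d−1} S(X_J)_ρ − E_{|I|=n−d+1} S(X_I)_ρ ), where the expectations are uniform averages over subsets of {1,…,n} of the indicated cardinality. -/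
open scoped BigOperators ComplexOrder

open Filter Topology

/-- Scalar comparison. -/
lemma aux_scalar {ι κ : Type*} [Fintype ι] [Fintype κ] (c x : ι → ℝ) (c' x' : κ → ℝ)
    (hx : ∀ i, 0 ≤ x i) (hx' : ∀ i, 0 ≤ x' i)
    (h0 : ∀ i, x i = 0 → c i = 0) (h0' : ∀ i, x' i = 0 → c' i = 0)
    (hs : ∑ i, c i = ∑ i, c' i)
    (hle : ∀ t : ℝ, 0 < t → ∑ i, c' i / (x' i + t) ≤ ∑ i, c i / (x i + t)) :
    ∑ i, c i * Real.log (x i) ≤ ∑ i, c' i * Real.log (x' i) := by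
  set F : ℝ → ℝ := fun t => ∑ i, c' i * Real.log (x' i + t) - ∑ i, c i * Real.log (x i + t) with hF
  have hd : ∀ t : ℝ, 0 < t → HasDerivAt F
      (∑ i, c' i * (1 / (x' i + t)) - ∑ i, c i * (1 / (x i + t))) t := by
    intro t ht
    refine HasDerivAt.sub (HasDerivAt.fun_sum fun i _ => ?_) (HasDerivAt.fun_sum fun i _ => ?_)
    · exact (((hasDerivAt_id t).const_add (x' i)).log (by have := hx' i; simp; linarith)).const_mul _
    · exact (((hasDerivAt_id t).const_add (x i)).log (by have := hx i; simp; linarith)).const_mul _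
  have hmono : MonotoneOn (fun t => - F t) (Set.Ioi 0) := by
    apply monotoneOn_of_deriv_nonneg (convex_Ioi 0)
    · exact fun t ht => (hd t ht).neg.continuousAt.continuousWithinAt
    · intro t ht
      rw [interior_Ioi] at ht
      exact (hd t ht).neg.differentiableAt.differentiableWithinAt
    · intro t ht
      rw [interior_Ioi] at ht
      have h1 := (hd t ht).fun_neg.deriv
      rw [h1]
      have := hle t ht
      simp only [mul_one_div]
      linarith
  have hF2 : ∀ t : ℝ, F t = ∑ i, c' i * (Real.log (x' i + t) - Real.log t) -
      ∑ i, c i * (Real.log (x i + t) - Real.log t) := by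
    intro t
    simp only [hF, mul_sub, Finset.sum_sub_distrib, ← Finset.sum_mul, hs]
    ring
  have hlog : ∀ y : ℝ, 0 ≤ y → Tendsto (fun t : ℝ => Real.log (y + t) - Real.log t) atTop (𝓝 0) := by
    intro y hy
    have h1 : Tendsto (fun t : ℝ => Real.log (y / t + 1)) atTop (𝓝 (Real.log (0 + 1))) := by
      refine Tendsto.log ?_ (by norm_num)
      exact (tendsto_const_nhds.div_atTop tendsto_id).add_const 1
    simp only [zero_add, Real.log_one] at h1
    refine h1.congr' ?_
    filter_upwards [eventually_gt_atTop 0] with t ht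
    rw [← Real.log_div (by linarith) ht.ne']
    congr 1
    field_simp
  have hlim : Tendsto F atTop (𝓝 0) := by
    have : Tendsto (fun t => ∑ i, c' i * (Real.log (x' i + t) - Real.log t) -
      ∑ i, c i * (Real.log (x i + t) - Real.log t)) atTop (𝓝 (∑ i, c' i * 0 - ∑ i, c i * 0)) :=
      (tendsto_finsetSum _ fun i _ => (hlog _ (hx' i)).const_mul _).sub
        (tendsto_finsetSum _ fun i _ => (hlog _ (hx i)).const_mul _)
    simp only [mul_zero, Finset.sum_const_zero, sub_zero] at this
    exact this.congr fun t => (hF2 t).symm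
  have hpos : ∀ t : ℝ, 0 < t → 0 ≤ F t := by
    intro t ht
    refine le_of_tendsto hlim ?_
    filter_upwards [eventually_ge_atTop t] with s hs
    have := hmono (Set.mem_Ioi.2 ht) (Set.mem_Ioi.2 (ht.trans_le hs)) hs
    simpa using this
  have hz : ∀ (y w : ℝ), 0 ≤ y → (y = 0 → w = 0) →
      Tendsto (fun t : ℝ => w * Real.log (y + t)) (𝓝[>] 0) (𝓝 (w * Real.log y)) := by
    intro y w hy hw
    by_cases h : y = 0
    · simp [hw h]
    · have : ContinuousAt (fun t : ℝ => w * Real.log (y + t)) 0 := by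
        refine continuousAt_const.mul (ContinuousAt.log (by fun_prop) (by simpa using h))
      have h2 := this.tendsto
      simp only [add_zero] at h2
      exact h2.mono_left nhdsWithin_le_nhds
  have hlim0 : Tendsto F (𝓝[>] 0)
      (𝓝 (∑ i, c' i * Real.log (x' i) - ∑ i, c i * Real.log (x i))) :=
    (tendsto_finsetSum _ fun i _ => hz _ _ (hx' i) (h0' i)).sub
      (tendsto_finsetSum _ fun i _ => hz _ _ (hx i) (h0 i))
  have := ge_of_tendsto hlim0 (by filter_upwards [self_mem_nhdsWithin] with t ht using hpos t ht)
  linarith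

/-- Concave sequences extrapolate. -/
lemma aux_concave (H : ℕ → ℝ) (n a b : ℕ) (hab : a < b) (hbn : b ≤ n)
    (hH : ∀ m, m + 2 ≤ n → H m + H (m + 2) ≤ 2 * H (m + 1)) :
    ((b : ℝ) - a) * (H n - H a) ≤ ((n : ℝ) - a) * (H b - H a) := by
  -- increments are antitone
  have hinc : ∀ i j, i ≤ j → j + 1 ≤ n → H (j + 1) - H j ≤ H (i + 1) - H i := by
    intro i j hij
    induction j, hij using Nat.le_induction with
    | base => intro _; exact le_rfl
    | succ j hj ih =>
      intro h
      have := hH j (by omega)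
      have := ih (by omega)
      linarith
  -- lower bound on [a,b]
  have h1 : ∀ k, a + k ≤ b → (k : ℝ) * (H b - H (b - 1)) ≤ H (a + k) - H a := by
    intro k
    induction k with
    | zero => intro _; simp
    | succ k ih =>
      intro h
      have := ih (by omega)
      have h2 := hinc (a + k) (b - 1) (by omega) (by omega)
      rw [show b - 1 + 1 = b by omega] at h2
      push_cast
      rw [← add_assoc a k 1]
      linarith
  have h2 : ∀ k, b + k ≤ n → H (b + k) - H b ≤ (k : ℝ) * (H b - H (b - 1)) := by
    intro k
    induction k with
    | zero => intro _; simp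
    | succ k ih =>
      intro h
      have := ih (by omega)
      have h2 := hinc (b - 1) (b + k) (by omega) (by omega)
      rw [show b - 1 + 1 = b by omega] at h2
      push_cast
      rw [← add_assoc b k 1]
      linarith
  have e1 := h1 (b - a) (by omega)
  have e2 := h2 (n - b) (by omega)
  rw [show a + (b - a) = b by omega, Nat.cast_sub hab.le] at e1
  rw [show b + (n - b) = n by omega, Nat.cast_sub hbn] at e2
  have p1 : (0 : ℝ) ≤ (b : ℝ) - a := by have : (a : ℝ) < b := by exact_mod_cast hab
                                        linarith
  have p2 : (0 : ℝ) ≤ (n : ℝ) - b := by have : (b : ℝ) ≤ n := by exact_mod_cast hbn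
                                        linarith
  nlinarith [mul_le_mul_of_nonneg_left e1 p2, mul_le_mul_of_nonneg_left e2 p1]

lemma aux_comb (n : ℕ) (g : Finset (Fin n) → ℝ)
    (hg : ∀ (K : Finset (Fin n)) (x y : Fin n), x ∉ K → y ∉ K → x ≠ y →
      g (insert x (insert y K)) + g K ≤ g (insert x K) + g (insert y K))
    (a b : ℕ) (hab : a < b) (hbn : b ≤ n) :
    ((b : ℝ) - a) * (g Finset.univ -
        (∑ I ∈ Finset.powersetCard a (Finset.univ : Finset (Fin n)), g I) / (n.choose a : ℝ)) ≤
      ((n : ℝ) - a) * ((∑ I ∈ Finset.powersetCard b (Finset.univ : Finset (Fin n)), g I)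
          / (n.choose b : ℝ) -
        (∑ I ∈ Finset.powersetCard a (Finset.univ : Finset (Fin n)), g I) / (n.choose a : ℝ)) := by
  classical
  set h : Finset (Fin n) → ℝ := fun S => ∑ π : Equiv.Perm (Fin n), g (S.map π.toEmbedding) with hh
  have hcard : ∀ S T : Finset (Fin n), S.card = T.card → h S = h T := by
    intro S T hST
    obtain ⟨σ, hσ⟩ : ∃ σ : Equiv.Perm (Fin n), S.map σ.toEmbedding = T := by
      have e : {x // x ∈ S} ≃ {x // x ∈ T} := Finset.equivOfCardEq hST
      refine ⟨e.extendSubtype, ?_⟩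
      apply Finset.eq_of_subset_of_card_le
      · intro z hz
        obtain ⟨w, hw, rfl⟩ := Finset.mem_map.1 hz
        exact e.extendSubtype_mem w hw
      · simp [hST]
    subst hσ
    simp only [hh]
    rw [← Equiv.sum_comp (Equiv.mulRight σ)]
    refine Finset.sum_congr rfl fun π _ => ?_
    rw [Finset.map_map]
    rfl
  have havg : ∀ m, m ≤ n → ∀ S : Finset (Fin n), S.card = m →
      (∑ I ∈ Finset.powersetCard m (Finset.univ : Finset (Fin n)), g I) / (n.choose m : ℝ)
        = h S / (n.factorial : ℝ) := by
    intro m hm S hS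
    have e1 : ∑ I ∈ Finset.powersetCard m (Finset.univ : Finset (Fin n)), h I
        = n.choose m * h S := by
      rw [Finset.sum_congr rfl (fun I hI => hcard I S
        (by rw [(Finset.mem_powersetCard.1 hI).2, hS]))]
      simp
    have e2 : ∑ I ∈ Finset.powersetCard m (Finset.univ : Finset (Fin n)), h I
        = n.factorial * ∑ I ∈ Finset.powersetCard m (Finset.univ : Finset (Fin n)), g I := by
      simp only [hh]
      rw [Finset.sum_comm]
      have : ∀ π : Equiv.Perm (Fin n),
          ∑ I ∈ Finset.powersetCard m (Finset.univ : Finset (Fin n)), g (I.map π.toEmbedding)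
          = ∑ I ∈ Finset.powersetCard m (Finset.univ : Finset (Fin n)), g I := by
        intro π
        refine Finset.sum_equiv π.finsetCongr ?_ ?_
        · intro I; simp [Finset.mem_powersetCard]
        · intro I _; rfl
      rw [Finset.sum_congr rfl fun π _ => this π]
      simp [Fintype.card_perm]
    have c1 : (0 : ℝ) < n.choose m := by exact_mod_cast Nat.choose_pos hm
    have c2 : (0 : ℝ) < n.factorial := by exact_mod_cast Nat.factorial_pos n
    rw [div_eq_div_iff c1.ne' c2.ne']
    linarith
  set P : ℕ → Finset (Fin n) := fun m => Finset.univ.filter (fun i : Fin n => (i : ℕ) < m) with hP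
  have hPc : ∀ m, m ≤ n → (P m).card = m := by
    intro m hm
    simp only [hP]
    rw [Fin.card_filter_val_lt]
    simpa using hm
  have hsub : ∀ m, m + 2 ≤ n → h (P m) + h (P (m + 2)) ≤ 2 * h (P (m + 1)) := by
    intro m hm
    set x : Fin n := ⟨m, by omega⟩
    set y : Fin n := ⟨m + 1, by omega⟩
    have hx : x ∉ P m := by simp [hP, x]
    have hy : y ∉ P m := by simp [hP, y]
    have hxy : x ≠ y := by simp [x, y]
    have h1 : h (insert x (insert y (P m))) + h (P m) ≤ h (insert x (P m)) + h (insert y (P m)) := by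
      simp only [hh, ← Finset.sum_add_distrib]
      refine Finset.sum_le_sum fun π _ => ?_
      simp only [Finset.map_insert]
      apply hg
      · simpa using hx
      · simpa using hy
      · simpa using hxy
    have c0 := hPc m (by omega)
    rw [hcard (insert x (insert y (P m))) (P (m + 2)) (by
        rw [Finset.card_insert_of_notMem (by simp [hxy, hx]), Finset.card_insert_of_notMem hy,
          hPc _ hm, c0]),
      hcard (insert x (P m)) (P (m + 1)) (by
        rw [Finset.card_insert_of_notMem hx, c0, hPc (m + 1) (by omega)]),
      hcard (insert y (P m)) (P (m + 1)) (by
        rw [Finset.card_insert_of_notMem hy, c0, hPc (m + 1) (by omega)])] at h1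
    linarith
  have hfin := aux_concave (fun m => h (P m) / (n.factorial : ℝ)) n a b hab hbn (by
    intro m hm
    have := hsub m hm
    have c2 : (0 : ℝ) < n.factorial := by exact_mod_cast Nat.factorial_pos n
    rw [← add_div, ← mul_div_assoc]
    gcongr)
  have hn := havg n le_rfl (P n) (hPc n le_rfl)
  have hu : Finset.powersetCard n (Finset.univ : Finset (Fin n)) = {Finset.univ} := by
    have := Finset.powersetCard_self (Finset.univ : Finset (Fin n))
    simpa using this
  rw [hu] at hn
  simp only [Finset.sum_singleton, Nat.choose_self, Nat.cast_one, div_one] at hn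
  rw [hn, havg a (by omega) (P a) (hPc a (by omega)), havg b hbn (P b) (hPc b hbn)]
  exact hfin
open Matrix

/-- Diagonalization data for a positive semidefinite matrix. -/
lemma aux_diag {m : Type*} [Fintype m] [DecidableEq m] (A : Matrix m m ℂ) (hA : A.PosSemidef) :
    ∃ (U : Matrix m m ℂ) (p : m → ℝ), U * Uᴴ = 1 ∧ Uᴴ * U = 1 ∧ (∀ i, 0 ≤ p i) ∧
      A = U * diagonal (fun i => (p i : ℂ)) * Uᴴ ∧
      vnEntropy A = - ∑ i, p i * Real.log (p i) := by
  refine ⟨hA.1.eigenvectorUnitary, hA.1.eigenvalues, ?_, ?_, hA.eigenvalues_nonneg, ?_, ?_⟩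
  · exact Unitary.coe_mul_star_self _
  · exact Unitary.coe_star_mul_self _
  · conv_lhs => rw [hA.1.spectral_theorem]
    rfl
  · rw [vnEntropy, dif_pos hA.1]

lemma aux_vn_submatrix {m k : Type*} [Fintype m] [DecidableEq m] [Fintype k] [DecidableEq k]
    (A : Matrix m m ℂ) (hA : A.IsHermitian) (e : k ≃ m) :
    vnEntropy (A.submatrix e e) = vnEntropy A := by
  have hB : (A.submatrix e e).IsHermitian := hA.submatrix e
  rw [vnEntropy, dif_pos hB, vnEntropy, dif_pos hA]
  have h1 := hA.roots_charpoly_eq_eigenvalues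
  have h2 := hB.roots_charpoly_eq_eigenvalues
  have h3 : (A.submatrix e e).charpoly = A.charpoly := by
    have := charpoly_reindex e.symm A
    simpa [reindex_apply] using this
  rw [h3, h1] at h2
  have h4 := congrArg (fun s : Multiset ℂ => (s.map (fun z => z.re * Real.log z.re)).sum) h2
  simp only [Multiset.map_map, Function.comp_def] at h4
  rw [neg_inj]
  exact h4.symm

lemma aux_quad {m : Type*} [Fintype m] [DecidableEq m] (U V Y : Matrix m m ℂ) (p q : m → ℝ)
    (hU : U * Uᴴ = 1) (hV : V * Vᴴ = 1) (t : ℝ)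
    {R T : Matrix m m ℂ}
    (hR : R = U * diagonal (fun i => (p i : ℂ)) * Uᴴ)
    (hT : T = V * diagonal (fun i => (q i : ℂ)) * Vᴴ) :
    2 * (R * Y).trace.re - (T * (Yᴴ * Y)).trace.re - t * (R * (Y * Yᴴ)).trace.re
      = ∑ i, ∑ j, (2 * p i * ((Uᴴ * Y * V) i j * (Vᴴ * U) j i).re
          - (q j + t * p i) * Complex.normSq ((Uᴴ * Y * V) i j)) := by
  set Z := Uᴴ * Y * V with hZ
  have e1 : (R * Y).trace = (diagonal (fun i => (p i : ℂ)) * (Z * (Vᴴ * U))).trace := by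
    have : Z * (Vᴴ * U) = Uᴴ * Y * U := by
      rw [hZ, ← Matrix.mul_assoc, Matrix.mul_assoc (Uᴴ * Y) V, hV, Matrix.mul_one]
    rw [this, hR, Matrix.mul_assoc, Matrix.mul_assoc, Matrix.trace_mul_comm]
    simp only [Matrix.mul_assoc]
  have e2 : (T * (Yᴴ * Y)).trace = (diagonal (fun i => (q i : ℂ)) * (Zᴴ * Z)).trace := by
    have : Zᴴ * Z = Vᴴ * (Yᴴ * Y) * V := by
      rw [hZ]
      simp only [conjTranspose_mul, conjTranspose_conjTranspose, Matrix.mul_assoc]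
      rw [← Matrix.mul_assoc U, hU, Matrix.one_mul]
    rw [this, hT, Matrix.mul_assoc, Matrix.mul_assoc, Matrix.trace_mul_comm]
    simp only [Matrix.mul_assoc]
  have e3 : (R * (Y * Yᴴ)).trace = (diagonal (fun i => (p i : ℂ)) * (Z * Zᴴ)).trace := by
    have : Z * Zᴴ = Uᴴ * (Y * Yᴴ) * U := by
      rw [hZ]
      simp only [conjTranspose_mul, conjTranspose_conjTranspose, Matrix.mul_assoc]
      rw [← Matrix.mul_assoc V, hV, Matrix.one_mul]
    rw [this, hR, Matrix.mul_assoc, Matrix.mul_assoc, Matrix.trace_mul_comm]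
    simp only [Matrix.mul_assoc]
  have f1 : (R * Y).trace.re = ∑ i, ∑ j, p i * (Z i j * (Vᴴ * U) j i).re := by
    rw [e1]
    simp only [trace, diag_apply, diagonal_mul, Complex.re_sum, Complex.re_ofReal_mul]
    refine Finset.sum_congr rfl fun i _ => ?_
    rw [Matrix.mul_apply, Complex.re_sum, Finset.mul_sum]
  have f2 : (T * (Yᴴ * Y)).trace.re = ∑ i, ∑ j, q j * Complex.normSq (Z i j) := by
    rw [e2]
    simp only [trace, diag_apply, diagonal_mul, Complex.re_sum, Complex.re_ofReal_mul]
    rw [Finset.sum_comm]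
    refine Finset.sum_congr rfl fun i _ => ?_
    rw [Matrix.mul_apply, Complex.re_sum, Finset.mul_sum]
    refine Finset.sum_congr rfl fun j _ => ?_
    simp [Complex.normSq_apply]
  have f3 : (R * (Y * Yᴴ)).trace.re = ∑ i, ∑ j, p i * Complex.normSq (Z i j) := by
    rw [e3]
    simp only [trace, diag_apply, diagonal_mul, Complex.re_sum, Complex.re_ofReal_mul]
    refine Finset.sum_congr rfl fun i _ => ?_
    rw [Matrix.mul_apply, Complex.re_sum, Finset.mul_sum]
    refine Finset.sum_congr rfl fun j _ => ?_
    simp [Complex.normSq_apply]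
  rw [f1, f2, f3, Finset.mul_sum, Finset.mul_sum, ← Finset.sum_sub_distrib,
    ← Finset.sum_sub_distrib]
  refine Finset.sum_congr rfl fun i _ => ?_
  rw [Finset.mul_sum, Finset.mul_sum, ← Finset.sum_sub_distrib, ← Finset.sum_sub_distrib]
  refine Finset.sum_congr rfl fun j _ => ?_
  ring

lemma aux_pt (p q t : ℝ) (hp : 0 ≤ p) (hq : 0 ≤ q) (ht : 0 < t) (z o : ℂ) :
    2 * p * (z * o).re - (q + t * p) * Complex.normSq z
      ≤ (p * Complex.normSq o) / (q / p + t) := by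
  rcases hp.eq_or_lt with rfl | hp
  · have := Complex.normSq_nonneg z
    simp
    positivity
  · have e : (p * Complex.normSq o) / (q / p + t) = p ^ 2 * Complex.normSq o / (q + t * p) := by
      field_simp
    have hs : 0 < q + t * p := by positivity
    rw [e, le_div_iff₀ hs]
    simp only [Complex.normSq_apply, Complex.mul_re]
    nlinarith [sq_nonneg ((q + t * p) * z.re - p * o.re), sq_nonneg ((q + t * p) * z.im + p * o.im)]

lemma aux_pt_eq (p q t : ℝ) (hp : 0 ≤ p) (hq : 0 ≤ q) (ht : 0 < t) (o : ℂ) :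
    2 * p * ((((p / (q + t * p) : ℝ) : ℂ) * star o) * o).re
      - (q + t * p) * Complex.normSq (((p / (q + t * p) : ℝ) : ℂ) * star o)
      = (p * Complex.normSq o) / (q / p + t) := by
  rcases hp.eq_or_lt with rfl | hp
  · simp
  · have hs : 0 < q + t * p := by positivity
    have e : (p * Complex.normSq o) / (q / p + t) = p ^ 2 * Complex.normSq o / (q + t * p) := by
      field_simp
    rw [e, mul_assoc (((p / (q + t * p) : ℝ) : ℂ)), Complex.re_ofReal_mul, Complex.normSq_mul, Complex.normSq_ofReal]
    have : (star o * o).re = Complex.normSq o := by simp [Complex.normSq_apply]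
    rw [this]
    have : Complex.normSq (star o) = Complex.normSq o := Complex.normSq_conj o
    rw [this]
    field_simp
    ring

/-- Monotonicity of the quadratic forms. -/
lemma aux_mono {m k : Type*} [Fintype m] [DecidableEq m] [Fintype k] [DecidableEq k]
    (Φ : Matrix k k ℂ → Matrix m m ℂ) (hΦm : ∀ A B, Φ (A * B) = Φ A * Φ B)
    (hΦs : ∀ A, Φ Aᴴ = (Φ A)ᴴ)
    {R T U V : Matrix m m ℂ} {R' T' U' V' : Matrix k k ℂ} {p q : m → ℝ} {p' q' : k → ℝ}
    (hR : R = U * diagonal (fun i => (p i : ℂ)) * Uᴴ)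
    (hT : T = V * diagonal (fun i => (q i : ℂ)) * Vᴴ)
    (hR' : R' = U' * diagonal (fun i => (p' i : ℂ)) * U'ᴴ)
    (hT' : T' = V' * diagonal (fun i => (q' i : ℂ)) * V'ᴴ)
    (hU : U * Uᴴ = 1) (hV : V * Vᴴ = 1) (hU' : U' * U'ᴴ = 1) (hV' : V' * V'ᴴ = 1)
    (hp : ∀ i, 0 ≤ p i) (hq : ∀ i, 0 ≤ q i) (hp' : ∀ i, 0 ≤ p' i) (hq' : ∀ i, 0 ≤ q' i)
    (hRΦ : ∀ Y, (R * Φ Y).trace = (R' * Y).trace)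
    (hTΦ : ∀ Y, (T * Φ Y).trace = (T' * Y).trace) (t : ℝ) (ht : 0 < t) :
    ∑ i, ∑ j, (p' i * Complex.normSq ((V'ᴴ * U') j i)) / (q' j / p' i + t)
      ≤ ∑ i, ∑ j, (p i * Complex.normSq ((Vᴴ * U) j i)) / (q j / p i + t) := by
  have hU'' : U'ᴴ * U' = 1 := mul_eq_one_comm.1 hU'
  have hV'' : V'ᴴ * V' = 1 := mul_eq_one_comm.1 hV'
  set Z : Matrix k k ℂ := fun i j =>
    ((p' i / (q' j + t * p' i) : ℝ) : ℂ) * star ((V'ᴴ * U') j i) with hZ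
  set Y := U' * Z * V'ᴴ with hY
  have hYZ : U'ᴴ * Y * V' = Z := by
    rw [hY]
    simp only [Matrix.mul_assoc]
    rw [hV'', Matrix.mul_one, ← Matrix.mul_assoc, hU'', Matrix.one_mul]
  have k1 := aux_quad U' V' Y p' q' hU' hV' t hR' hT'
  have k2 := aux_quad U V (Φ Y) p q hU hV t hR hT
  rw [← hΦs, ← hΦm, ← hΦm, hRΦ, hRΦ, hTΦ, k1, hYZ] at k2
  calc _ = _ := Finset.sum_congr rfl fun i _ => Finset.sum_congr rfl fun j _ =>
        (aux_pt_eq (p' i) (q' j) t (hp' i) (hq' j) ht ((V'ᴴ * U') j i)).symm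
    _ = _ := k2
    _ ≤ _ := Finset.sum_le_sum fun i _ => Finset.sum_le_sum fun j _ =>
        aux_pt _ _ t (hp i) (hq j) ht _ _

/-- Conditional entropy bookkeeping. -/
lemma aux_cond {α β : Type*} [Fintype α] [DecidableEq α] [Fintype β] [DecidableEq β]
    {R U : Matrix (α × β) (α × β) ℂ} {T V : Matrix β β ℂ} {p : α × β → ℝ} {q : β → ℝ}
    (hR : R = U * diagonal (fun i => (p i : ℂ)) * Uᴴ)
    (hT : T = V * diagonal (fun i => (q i : ℂ)) * Vᴴ)
    (hU : U * Uᴴ = 1) (hV : V * Vᴴ = 1) (hp : ∀ i, 0 ≤ p i)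
    (hRT : ∀ b b', T b b' = ∑ a, R (a, b) (a, b'))
    {W : Matrix (α × β) (α × β) ℂ} (hW : W = kronecker (1 : Matrix α α ℂ) V) :
    W * Wᴴ = 1 ∧ kronecker (1 : Matrix α α ℂ) T = W * diagonal (fun i => (q i.2 : ℂ)) * Wᴴ ∧
    (∑ i, ∑ j, p i * Complex.normSq ((Wᴴ * U) j i) = R.trace.re) ∧
    (∀ i j, q j.2 / p i = 0 → p i * Complex.normSq ((Wᴴ * U) j i) = 0) ∧
    ∑ i, ∑ j, p i * Complex.normSq ((Wᴴ * U) j i) * Real.log (q j.2 / p i)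
      = ∑ j, q j * Real.log (q j) - ∑ i, p i * Real.log (p i) := by
  have hV'' : Vᴴ * V = 1 := mul_eq_one_comm.1 hV
  have hU'' : Uᴴ * U = 1 := mul_eq_one_comm.1 hU
  have hWs : Wᴴ = kronecker (1 : Matrix α α ℂ) Vᴴ := by
    rw [hW]; simp [kronecker, conjTranspose_kronecker]
  have hWW : W * Wᴴ = 1 := by
    rw [hWs, hW]
    simp only [kronecker]
    rw [← mul_kronecker_mul, hV, Matrix.one_mul, one_kronecker_one]
  have hWW' : Wᴴ * W = 1 := mul_eq_one_comm.1 hWW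
  have hrow : ∀ i, ∑ j, Complex.normSq ((Wᴴ * U) j i) = 1 := by
    intro i
    have h1 : (Wᴴ * U)ᴴ * (Wᴴ * U) = 1 := by
      rw [conjTranspose_mul, conjTranspose_conjTranspose, Matrix.mul_assoc, ← Matrix.mul_assoc W,
        hWW, Matrix.one_mul, hU'']
    have h2 := congrArg Complex.re (congrFun (congrFun h1 i) i)
    rw [Matrix.mul_apply, Complex.re_sum, one_apply_eq] at h2
    rw [Complex.one_re] at h2
    rw [← h2]
    refine Finset.sum_congr rfl fun j _ => ?_
    simp [Complex.normSq_apply]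
  have hcol : ∀ j, ((∑ i, p i * Complex.normSq ((Wᴴ * U) j i) : ℝ) : ℂ) = (Wᴴ * R * W) j j := by
    intro j
    have : Wᴴ * R * W = (Wᴴ * U) * diagonal (fun i => (p i : ℂ)) * (Wᴴ * U)ᴴ := by
      rw [conjTranspose_mul, conjTranspose_conjTranspose, hR]
      simp only [Matrix.mul_assoc]
    rw [this, Matrix.mul_apply]
    push_cast
    refine Finset.sum_congr rfl fun i _ => ?_
    rw [mul_diagonal, conjTranspose_apply, ← Complex.mul_conj]
    simp only [RCLike.star_def]
    ring
  have hq : ∀ j : β, ∑ a : α, ∑ i, p i * Complex.normSq ((Wᴴ * U) (a, j) i) = q j := by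
    intro j
    have h1 : (∑ a : α, (Wᴴ * R * W) (a, j) (a, j)) = (Vᴴ * T * V) j j := by
      have h2 : ∀ a, (Wᴴ * R * W) (a, j) (a, j) = ∑ b', ∑ b, Vᴴ j b * R (a, b) (a, b') * V b' j := by
        intro a
        rw [hWs, hW]
        simp only [Matrix.mul_apply, Fintype.sum_prod_type, kronecker, kroneckerMap_apply,
          one_apply, ite_mul, mul_ite, one_mul, zero_mul, mul_zero, Finset.sum_mul]
        simp
      simp only [h2]
      rw [Finset.sum_comm]
      simp only [Matrix.mul_apply, hRT, Finset.mul_sum, Finset.sum_mul]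
      refine Finset.sum_congr rfl fun b' _ => ?_
      rw [Finset.sum_comm]
    have h3 : Vᴴ * T * V = diagonal (fun i => (q i : ℂ)) := by
      rw [hT]
      simp only [Matrix.mul_assoc]
      rw [hV'', Matrix.mul_one, ← Matrix.mul_assoc, hV'', Matrix.one_mul]
    rw [h3, diagonal_apply_eq] at h1
    simp only [← hcol] at h1
    exact_mod_cast h1
  have hnn : ∀ i j, 0 ≤ p i * Complex.normSq ((Wᴴ * U) j i) := fun i j =>
    mul_nonneg (hp i) (Complex.normSq_nonneg _)
  have hsupp : ∀ i j, q j.2 / p i = 0 → p i * Complex.normSq ((Wᴴ * U) j i) = 0 := by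
    rintro i ⟨a, j⟩ h
    rcases div_eq_zero_iff.1 h with h | h
    · simp only at h
      have h1 := hq j
      rw [h, Finset.sum_eq_zero_iff_of_nonneg
        (fun a _ => Finset.sum_nonneg fun i _ => hnn i (a, j))] at h1
      have h2 := h1 a (Finset.mem_univ _)
      rw [Finset.sum_eq_zero_iff_of_nonneg (fun i _ => hnn i (a, j))] at h2
      exact h2 i (Finset.mem_univ _)
    · simp [h]
  refine ⟨hWW, ?_, ?_, hsupp, ?_⟩
  · have hd : diagonal (fun i : α × β => (q i.2 : ℂ))
        = kronecker (1 : Matrix α α ℂ) (diagonal (fun i => (q i : ℂ))) := by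
      rw [← diagonal_one]
      simp only [kronecker]
      rw [diagonal_kronecker_diagonal]
      simp
    rw [hd, hWs, hW, hT]
    simp only [kronecker]
    rw [← mul_kronecker_mul, ← mul_kronecker_mul]
    simp
  · simp only [← Finset.mul_sum, hrow, mul_one]
    have : R.trace = ∑ i, (p i : ℂ) := by
      rw [hR, Matrix.mul_assoc, Matrix.trace_mul_comm, Matrix.mul_assoc, hU'', Matrix.mul_one,
        trace_diagonal]
    rw [this, Complex.re_sum]
    simp
  · have hterm : ∀ i j, p i * Complex.normSq ((Wᴴ * U) j i) * Real.log (q j.2 / p i)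
        = p i * Complex.normSq ((Wᴴ * U) j i) * Real.log (q j.2)
          - p i * Real.log (p i) * Complex.normSq ((Wᴴ * U) j i) := by
      intro i j
      by_cases h : q j.2 / p i = 0
      · have h2 := hsupp i j h
        rcases mul_eq_zero.1 h2 with h3 | h3 <;> simp [h3]
      · rw [Real.log_div (fun h1 => h (by simp [h1])) (fun h1 => h (by simp [h1]))]
        ring
    simp only [hterm, Finset.sum_sub_distrib, ← Finset.mul_sum, hrow, mul_one]
    congr 1
    rw [Finset.sum_comm, Fintype.sum_prod_type, Finset.sum_comm]
    refine Finset.sum_congr rfl fun j _ => ?_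
    simp only [← Finset.sum_mul]
    rw [hq]

lemma aux_scalar_two {ι κ : Type*} [Fintype ι] [Fintype κ] (c x : ι → ι → ℝ) (c' x' : κ → κ → ℝ)
    (hx : ∀ i j, 0 ≤ x i j) (hx' : ∀ i j, 0 ≤ x' i j)
    (h0 : ∀ i j, x i j = 0 → c i j = 0) (h0' : ∀ i j, x' i j = 0 → c' i j = 0)
    (hs : ∑ i, ∑ j, c i j = ∑ i, ∑ j, c' i j)
    (hle : ∀ t : ℝ, 0 < t → ∑ i, ∑ j, c' i j / (x' i j + t) ≤ ∑ i, ∑ j, c i j / (x i j + t)) :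
    ∑ i, ∑ j, c i j * Real.log (x i j) ≤ ∑ i, ∑ j, c' i j * Real.log (x' i j) := by
  have key := aux_scalar (ι := ι × ι) (κ := κ × κ) (fun z => c z.1 z.2) (fun z => x z.1 z.2)
    (fun z => c' z.1 z.2) (fun z => x' z.1 z.2) (fun z => hx _ _) (fun z => hx' _ _)
    (fun z => h0 _ _) (fun z => h0' _ _)
    (by simpa only [Fintype.sum_prod_type] using hs)
    (by simpa only [Fintype.sum_prod_type] using hle)
  simpa only [Fintype.sum_prod_type] using key

/-- Strong subadditivity. -/
lemma aux_ssa {α β γ : Type*} [Fintype α] [DecidableEq α] [Fintype β] [DecidableEq β]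
    [Fintype γ] [DecidableEq γ]
    (R : Matrix (α × β × γ) (α × β × γ) ℂ) (Rab : Matrix (α × β) (α × β) ℂ)
    (Rbc : Matrix (β × γ) (β × γ) ℂ) (Rb : Matrix β β ℂ)
    (hR : R.PosSemidef) (hRab : Rab.PosSemidef) (hRbc : Rbc.PosSemidef) (hRb : Rb.PosSemidef)
    (h1 : ∀ a b a' b', Rab (a, b) (a', b') = ∑ c, R (a, b, c) (a', b', c))
    (h2 : ∀ b c b' c', Rbc (b, c) (b', c') = ∑ a, R (a, b, c) (a, b', c'))
    (h3 : ∀ b b', Rb b b' = ∑ c, Rbc (b, c) (b', c)) :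
    vnEntropy R + vnEntropy Rb ≤ vnEntropy Rab + vnEntropy Rbc := by
  obtain ⟨U, p, hU, -, hp, eR, sR⟩ := aux_diag R hR
  obtain ⟨V, q, hV, -, hq, eT, sT⟩ := aux_diag Rbc hRbc
  obtain ⟨U', p', hU', -, hp', eR', sR'⟩ := aux_diag Rab hRab
  obtain ⟨V', q', hV', -, hq', eT', sT'⟩ := aux_diag Rb hRb
  obtain ⟨hW, eK, htr, hsupp, hlog⟩ := aux_cond eR eT hU hV hp
    (by rintro ⟨b, c⟩ ⟨b', c'⟩; exact h2 b c b' c') rfl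
  obtain ⟨hW', eK', htr', hsupp', hlog'⟩ := aux_cond eR' eT' hU' hV' hp'
    (by
      intro b b'
      rw [h3]
      simp only [h2, h1]
      rw [Finset.sum_comm]) rfl
  have hm := aux_mono
    (fun Y : Matrix (α × β) (α × β) ℂ => ((kronecker Y (1 : Matrix γ γ ℂ)).submatrix
      (Equiv.prodAssoc α β γ).symm (Equiv.prodAssoc α β γ).symm))
    (by
      intro A B
      simp only [kronecker]
      rw [submatrix_mul_equiv, ← mul_kronecker_mul, Matrix.mul_one])
    (by
      intro A
      simp [kronecker, conjTranspose_kronecker, conjTranspose_submatrix])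
    eR eK eR' eK' hU hW hU' hW' hp (fun i => hq i.2) hp' (fun i => hq' i.2)
    (by
      intro Y
      simp only [trace, diag_apply, Matrix.mul_apply, Fintype.sum_prod_type, kronecker,
        submatrix_apply, kroneckerMap_apply, Equiv.prodAssoc_symm_apply, one_apply, mul_ite,
        mul_one, mul_zero, Finset.sum_ite_eq, Finset.sum_ite_eq', Finset.mem_univ, if_true, h1,
        Finset.sum_mul]
      refine Finset.sum_congr rfl fun a _ => Finset.sum_congr rfl fun b _ => ?_
      rw [Finset.sum_comm]
      refine Finset.sum_congr rfl fun a' _ => ?_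
      rw [Finset.sum_comm])
    (by
      intro Y
      simp only [trace, diag_apply, Matrix.mul_apply, Fintype.sum_prod_type, kronecker,
        submatrix_apply, kroneckerMap_apply, Equiv.prodAssoc_symm_apply, one_apply, mul_ite,
        mul_one, mul_zero, Finset.sum_ite_eq, Finset.sum_ite_eq', Finset.mem_univ, if_true, h3,
        Finset.sum_mul, ite_mul, one_mul, zero_mul]
      refine Finset.sum_congr rfl fun a _ => Finset.sum_congr rfl fun b _ => ?_
      rw [Finset.sum_comm]
      refine Finset.sum_congr rfl fun a' _ => ?_
      rw [Finset.sum_comm]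
      refine Finset.sum_congr rfl fun b' _ => ?_
      by_cases h : a = a' <;> simp [h, Finset.sum_mul])
  have htt : R.trace = Rab.trace := by
    simp only [trace, diag_apply, Fintype.sum_prod_type, h1]
  have key := aux_scalar_two
    (fun i j => p i * Complex.normSq (((kronecker (1 : Matrix α α ℂ) V)ᴴ * U) j i))
    (fun i j => q j.2 / p i)
    (fun i j => p' i * Complex.normSq (((kronecker (1 : Matrix α α ℂ) V')ᴴ * U') j i))
    (fun i j => q' j.2 / p' i)
    (fun _ _ => div_nonneg (hq _) (hp _)) (fun _ _ => div_nonneg (hq' _) (hp' _))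
    hsupp hsupp' (by rw [htr, htr', htt]) hm
  rw [hlog, hlog'] at key
  rw [sR, sT, sR', sT']
  linarith
lemma aux_marg_psd {ι : Type*} [Fintype ι] [DecidableEq ι] {dim : ι → ℕ}
    (ρ : Matrix ((i : ι) → Fin (dim i)) ((i : ι) → Fin (dim i)) ℂ) (hρ : ρ.PosSemidef)
    (S : Finset ι) : (marginal ρ S).PosSemidef := by
  have : marginal ρ S = ∑ z : (i : {j : ι // j ∉ S}) → Fin (dim i.1),
      ρ.submatrix (fun x i => if h : i ∈ S then x ⟨i, h⟩ else z ⟨i, h⟩)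
        (fun x i => if h : i ∈ S then x ⟨i, h⟩ else z ⟨i, h⟩) := by
    ext x y
    rw [Matrix.sum_apply]
    rfl
  rw [this]
  exact Matrix.posSemidef_sum _ fun z _ => hρ.submatrix _

lemma aux_step {ι : Type*} [Fintype ι] [DecidableEq ι] {dim : ι → ℕ}
    (ρ : Matrix ((i : ι) → Fin (dim i)) ((i : ι) → Fin (dim i)) ℂ)
    (S : Finset ι) (x : ι) (hx : x ∉ S) (f g : (i : ι) → Fin (dim i)) :
    marginal ρ S (fun i => f i) (fun i => g i) = ∑ s : Fin (dim x),
      marginal ρ (insert x S) (fun i => Function.update f x s i)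
        (fun i => Function.update g x s i) := by
  simp only [marginal]
  rw [← Fintype.sum_prod_type' (f := fun (s : Fin (dim x))
    (z : (i : {j : ι // j ∉ insert x S}) → Fin (dim i.1)) =>
      ρ (fun i => if h : i ∈ insert x S then Function.update f x s i else z ⟨i, h⟩)
        (fun i => if h : i ∈ insert x S then Function.update g x s i else z ⟨i, h⟩))]
  refine Fintype.sum_bijective
    (fun z : (i : {j : ι // j ∉ S}) → Fin (dim i.1) =>
      ((z ⟨x, hx⟩, fun i => z ⟨i.1, fun h => i.2 (Finset.mem_insert_of_mem h)⟩) :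
        Fin (dim x) × ((i : {j : ι // j ∉ insert x S}) → Fin (dim i.1)))) ⟨?_, ?_⟩ _ _ ?_
  · intro z w h
    obtain ⟨h1, h2⟩ := Prod.mk.inj h
    funext ⟨i, hi⟩
    by_cases hix : i = x
    · subst hix; exact h1
    · exact congrFun h2 ⟨i, by simp [hix, hi]⟩
  · rintro ⟨s, z⟩
    refine ⟨fun i => if h : i.1 ∈ insert x S then Function.update f x s i.1 else z ⟨i.1, h⟩, ?_⟩
    refine Prod.ext ?_ ?_
    · simp
    · funext ⟨i, hi⟩
      simp only
      rw [dif_neg hi]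
  · intro z
    have : ∀ f : (i : ι) → Fin (dim i), (fun i => if h : i ∈ S then f i else z ⟨i, h⟩)
        = (fun i => if h : i ∈ insert x S then Function.update f x (z ⟨x, hx⟩) i
          else z ⟨i, fun h' => h (Finset.mem_insert_of_mem h')⟩) := by
      intro f
      funext i
      by_cases hix : i = x
      · subst hix; simp [hx]
      · by_cases hi : i ∈ S <;> simp [hix, hi]
    rw [this f, this g]

/-- Reindexing: gluing a value at `x` to a configuration on `S`. -/
lemma aux_bij_one {ι : Type*} [Fintype ι] [DecidableEq ι] {dim : ι → ℕ}
    (f₀ : (i : ι) → Fin (dim i)) (K : Finset ι) (y : ι) (hy : y ∉ K) :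
    Function.Bijective (fun (v : ((i : {j : ι // j ∈ K}) → Fin (dim i.1)) × Fin (dim y)) =>
      (fun i : {j : ι // j ∈ insert y K} =>
        Function.update (fun i => if h : i ∈ K then v.1 ⟨i, h⟩ else f₀ i) y v.2 i.1)) := by
  constructor
  · rintro ⟨k, c⟩ ⟨k', c'⟩ h
    have h1 := congrFun h ⟨y, by simp⟩
    have h2 : k = k' := by
      funext ⟨i, hi⟩
      have h3 := congrFun h ⟨i, by simp [hi]⟩
      have hiy : i ≠ y := by rintro rfl; exact hy hi
      simpa [hiy, hi] using h3
    simp at h1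
    simp [h1, h2]
  · intro w
    refine ⟨(fun i => w ⟨i.1, by simp [i.2]⟩, w ⟨y, by simp⟩), ?_⟩
    funext ⟨i, hi⟩
    by_cases hiy : i = y
    · subst hiy; simp
    · have : i ∈ K := by simpa [hiy] using hi
      simp [hiy, this]

lemma aux_bij_two {ι : Type*} [Fintype ι] [DecidableEq ι] {dim : ι → ℕ}
    (f₀ : (i : ι) → Fin (dim i)) (K : Finset ι) (x y : ι) (hx : x ∉ K) (hy : y ∉ K) (hxy : x ≠ y) :
    Function.Bijective
      (fun (v : Fin (dim x) × ((i : {j : ι // j ∈ K}) → Fin (dim i.1)) × Fin (dim y)) =>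
      (fun i : {j : ι // j ∈ insert x (insert y K)} =>
        Function.update (Function.update
          (fun i => if h : i ∈ K then v.2.1 ⟨i, h⟩ else f₀ i) y v.2.2) x v.1 i.1)) := by
  constructor
  · rintro ⟨a, k, c⟩ ⟨a', k', c'⟩ h
    have h0 := congrFun h ⟨x, by simp⟩
    have h1 := congrFun h ⟨y, by simp⟩
    have h2 : k = k' := by
      funext ⟨i, hi⟩
      have h3 := congrFun h ⟨i, by simp [hi]⟩
      have hiy : i ≠ y := by rintro rfl; exact hy hi
      have hix : i ≠ x := by rintro rfl; exact hx hi
      simpa [hiy, hix, hi] using h3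
    simp at h0
    simp [hxy.symm] at h1
    simp [h0, h1, h2]
  · intro w
    refine ⟨(w ⟨x, by simp⟩, fun i => w ⟨i.1, by simp [i.2]⟩, w ⟨y, by simp⟩), ?_⟩
    funext ⟨i, hi⟩
    by_cases hix : i = x
    · subst hix; simp
    by_cases hiy : i = y
    · subst hiy; simp [hix]
    · have : i ∈ K := by simpa [hiy, hix] using hi
      simp [hiy, hix, this]

lemma aux_mEnt_ssa {ι : Type*} [Fintype ι] [DecidableEq ι] {dim : ι → ℕ}
    (ρ : Matrix ((i : ι) → Fin (dim i)) ((i : ι) → Fin (dim i)) ℂ) (hρ : ρ.PosSemidef)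
    (f₀ : (i : ι) → Fin (dim i)) (K : Finset ι) (x y : ι) (hx : x ∉ K) (hy : y ∉ K) (hxy : x ≠ y) :
    mEnt ρ (insert x (insert y K)) + mEnt ρ K ≤ mEnt ρ (insert x K) + mEnt ρ (insert y K) := by
  set L : ((i : {j : ι // j ∈ K}) → Fin (dim i.1)) → (i : ι) → Fin (dim i) :=
    fun k i => if h : i ∈ K then k ⟨i, h⟩ else f₀ i with hL
  have hLk : ∀ k, (fun i : {j : ι // j ∈ K} => L k i.1) = k := by
    intro k
    funext ⟨i, hi⟩
    simp [hL, hi]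
  let e3 := Equiv.ofBijective _ (aux_bij_two f₀ K x y hx hy hxy)
  let ey := Equiv.ofBijective _ (aux_bij_one f₀ K y hy)
  let ex := (Equiv.prodComm _ _).trans (Equiv.ofBijective _ (aux_bij_one f₀ K x hx))
  have key := aux_ssa
    ((marginal ρ (insert x (insert y K))).submatrix e3 e3)
    ((marginal ρ (insert x K)).submatrix ex ex)
    ((marginal ρ (insert y K)).submatrix ey ey)
    (marginal ρ K)
    ((aux_marg_psd ρ hρ _).submatrix _) ((aux_marg_psd ρ hρ _).submatrix _)
    ((aux_marg_psd ρ hρ _).submatrix _) (aux_marg_psd ρ hρ _)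
    (by
      intro a b a' b'
      have h := aux_step ρ (insert x K) y (by simp [hy, hxy.symm])
        (Function.update (L b) x a) (Function.update (L b') x a')
      rw [Finset.insert_comm] at h
      simp only [Function.update_comm hxy] at h
      exact h)
    (by
      intro b c b' c'
      exact aux_step ρ (insert y K) x (by simp [hx, hxy])
        (Function.update (L b) y c) (Function.update (L b') y c'))
    (by
      intro b b'
      have h := aux_step ρ K y hy (L b) (L b')
      rw [hLk, hLk] at h
      exact h)
  rw [aux_vn_submatrix _ (aux_marg_psd ρ hρ _).1, aux_vn_submatrix _ (aux_marg_psd ρ hρ _).1,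
    aux_vn_submatrix _ (aux_marg_psd ρ hρ _).1] at key
  exact key

/-- for any state on `X_1 ⊗ ⋯ ⊗ X_n` and `d ≤ n` with `2(d-1) > n`:
`S(X_[n]) ≤ E_I S(X_I) + ((d-1)/(2d-2-n)) (E_J S(X_J) - E_I S(X_I))`. -/
theorem total_entropy_interpolation_bound
    (n d : ℕ) (hdn : d ≤ n) (hdn2 : n < 2 * (d - 1))
    (dim : Fin n → ℕ)
    (ρ : Matrix ((i : Fin n) → Fin (dim i)) ((i : Fin n) → Fin (dim i)) ℂ)
    (hpsd : ρ.PosSemidef) (htr : ρ.trace = 1) :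
    mEnt ρ (Finset.univ : Finset (Fin n))
      ≤ (∑ I ∈ Finset.powersetCard (n - d + 1) (Finset.univ : Finset (Fin n)),
            mEnt ρ I) / (n.choose (n - d + 1) : ℝ)
        + (((d : ℝ) - 1) / (2 * (d : ℝ) - 2 - n)) *
          ((∑ J ∈ Finset.powersetCard (d - 1) (Finset.univ : Finset (Fin n)),
              mEnt ρ J) / (n.choose (d - 1) : ℝ)
            - (∑ I ∈ Finset.powersetCard (n - d + 1) (Finset.univ : Finset (Fin n)),
                mEnt ρ I) / (n.choose (n - d + 1) : ℝ)) := by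
  have hne : Nonempty ((i : Fin n) → Fin (dim i)) := by
    by_contra h
    rw [not_nonempty_iff] at h
    simp [Matrix.trace] at htr
  obtain ⟨f₀⟩ := hne
  have key := aux_comb n (mEnt ρ) (fun K x y hx hy hxy => aux_mEnt_ssa ρ hpsd f₀ K x y hx hy hxy)
    (n - d + 1) (d - 1) (by omega) (by omega)
  have hd : 1 ≤ d := by omega
  have hpos : (0 : ℝ) < 2 * (d : ℝ) - 2 - n := by
    have : ((n : ℕ) : ℝ) < ((2 * (d - 1) : ℕ) : ℝ) := by exact_mod_cast hdn2
    push_cast [Nat.cast_sub hd] at this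
    linarith
  push_cast [Nat.cast_sub hd, Nat.cast_sub hdn] at key
  rw [show (d : ℝ) - 1 - ((n : ℝ) - d + 1) = 2 * (d : ℝ) - 2 - n by ring,
    show (n : ℝ) - ((n : ℝ) - d + 1) = (d : ℝ) - 1 by ring] at key
  rw [← sub_le_iff_le_add', div_mul_eq_mul_div, le_div_iff₀ hpos]
  linarith
end
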